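/- Let q be a prime power of characteristic p and f(x) ∈ F_q[x] a polynomial of degree k+m ≤ q−1 with k ≥ 1, m ≥ 0. Let N(f, k+m) be the number of polynomials g of degree at most k−1 such that f+g has exactly k+m distinct roots in F_q (i.e. splits into distinct linear factors). Then |N(f, k+m) − q^{−m} C(q, k+m)| ≤ C(q/p + m√q + k + m, k+m). -/

import Mathlib

open Polynomial

/-- Generalized (real-argument) binomial coefficient `C(a,b) = Γ(a+1)/(Γ(b+1)Γ(a-b+1))`. -/
noncomputable def gchoose (a b : ℝ) : ℝ :=
  Real.Gamma (a + 1) / (Real.Gamma (b + 1) * Real.Gamma (a - b + 1))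

/-- coefficients of (1-u)^{-(A+1)} -/
noncomputable def Cc (A : ℝ) (n : ℕ) : ℝ := ∏ i ∈ Finset.range n, (A + (i + 1)) / (i + 1)

lemma Cc_pos {A : ℝ} (hA : 0 ≤ A) (n : ℕ) : 0 < Cc A n := by
  unfold Cc; exact Finset.prod_pos fun i _ => by positivity

lemma Cc_succ (A : ℝ) (n : ℕ) : ((n:ℝ) + 1) * Cc A (n+1) = (A + (n+1)) * Cc A n := by
  unfold Cc; rw [Finset.prod_range_succ]; field_simp

lemma Cc_mono {A : ℝ} (hA : 0 ≤ A) : Monotone (Cc A) := by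
  refine monotone_nat_of_le_succ fun n => ?_
  have := Cc_succ A n
  have h1 := Cc_pos hA n
  have h2 : 0 ≤ A * Cc A n := by positivity
  have : ((n:ℝ)+1) * Cc A n ≤ (n+1) * Cc A (n+1) := by nlinarith
  exact le_of_mul_le_mul_left this (by positivity)

lemma Cc_sum (A : ℝ) (n : ℕ) : (n:ℝ) * Cc A n = (A+1) * ∑ i ∈ Finset.range n, Cc A i := by
  induction n with
  | zero => simp
  | succ n ih =>
    rw [Finset.sum_range_succ, mul_add, ← ih]
    push_cast
    rw [Cc_succ]; ring

lemma gchoose_eq {A : ℝ} (hA : 0 ≤ A) (n : ℕ) : gchoose (A + n) n = Cc A n := by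
  unfold gchoose
  rw [Real.Gamma_nat_eq_factorial, show A + n - n + 1 = A + 1 by ring]
  have h0 : Real.Gamma (A+1) ≠ 0 := (Real.Gamma_pos_of_pos (by positivity)).ne'
  have hf : (n.factorial : ℝ) ≠ 0 := by positivity
  rw [div_eq_iff (mul_ne_zero hf h0)]
  induction n with
  | zero => simp [Cc]
  | succ n ih =>
    have hf : (n.factorial : ℝ) ≠ 0 := by positivity
    push_cast [Nat.factorial_succ]
    rw [Real.Gamma_add_one (by positivity), ← add_assoc, ih hf]
    have := Cc_succ A n
    linear_combination (-(n.factorial : ℝ) * Real.Gamma (A+1)) * this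

lemma sum_mult_le {A : ℝ} (hA : 0 ≤ A) (p : ℕ) (hp : 0 < p) (n : ℕ) :
    (p:ℝ) * ∑ i ∈ (Finset.range n).filter (fun i => p ∣ n - i), Cc A i ≤
      ∑ i ∈ Finset.range n, Cc A i := by
  induction n using Nat.strong_induction_on with
  | _ n ih =>
    rcases lt_or_ge n p with h | h
    · rw [Finset.filter_false_of_mem]
      · simp only [Finset.sum_empty, mul_zero]
        exact Finset.sum_nonneg fun i _ => (Cc_pos hA i).le
      · intro i hi hd
        have := Finset.mem_range.1 hi
        have := Nat.le_of_dvd (by omega) hd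
        omega
    · obtain ⟨k, rfl⟩ := Nat.exists_eq_add_of_le' h
      have key : (Finset.range (k+p)).filter (fun i => p ∣ k + p - i) =
          insert k ((Finset.range k).filter (fun i => p ∣ k - i)) := by
        ext i
        simp only [Finset.mem_filter, Finset.mem_range, Finset.mem_insert]
        constructor
        · rintro ⟨h1, h2⟩
          rcases lt_trichotomy i k with h3 | h3 | h3
          · right; refine ⟨h3, ?_⟩
            rw [show k + p - i = (k - i) + p by omega] at h2
            exact (Nat.dvd_add_left dvd_rfl).1 h2
          · left; exact h3
          · have := Nat.le_of_dvd (by omega) h2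
            omega
        · rintro (rfl | ⟨h1, h2⟩)
          · simp [hp]
          · refine ⟨by omega, ?_⟩
            rw [show k + p - i = (k - i) + p by omega]
            exact (Nat.dvd_add_left dvd_rfl).2 h2
      rw [key, Finset.sum_insert (by simp), mul_add, Finset.sum_range_add, add_comm]
      refine add_le_add (ih k (by omega)) ?_
      calc (p:ℝ) * Cc A k = ∑ i ∈ Finset.range p, Cc A k := by simp
        _ ≤ _ := Finset.sum_le_sum fun i _ => Cc_mono hA (by omega)

lemma newton_aeval {σ : Type*} [Fintype σ] (z : σ → ℂ) (n : ℕ) :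
    (n:ℂ) * (Finset.univ.val.map z).esymm n = (-1)^(n+1) *
      ∑ i ∈ Finset.range n, (-1)^i * (Finset.univ.val.map z).esymm i * ∑ x, z x ^ (n - i) := by
  have h := congrArg (MvPolynomial.aeval z) (MvPolynomial.mul_esymm_eq_sum σ ℂ n)
  simp only [map_mul, map_natCast, map_pow, map_neg, map_one, map_sum,
    MvPolynomial.aeval_esymm_eq_multiset_esymm, MvPolynomial.psum, MvPolynomial.aeval_X] at h
  rw [h]
  congr 1
  rw [Finset.sum_filter, Finset.Nat.sum_antidiagonal_eq_sum_range_succ_mk, Finset.sum_range_succ]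
  simp only [lt_self_iff_false, if_false, add_zero]
  exact Finset.sum_congr rfl fun i hi => by simp [Finset.mem_range.1 hi]

lemma esymm_bound {σ : Type*} [Fintype σ] (z : σ → ℂ) (p : ℕ) (hp : 0 < p) (B Q : ℝ)
    (hB : 0 ≤ B) (hQ : 0 ≤ Q)
    (h1 : ∀ j, 0 < j → ¬ p ∣ j → ‖∑ x, z x ^ j‖ ≤ B)
    (h2 : ∀ j, 0 < j → p ∣ j → ‖∑ x, z x ^ j‖ ≤ Q) (n : ℕ) :
    ‖(Finset.univ.val.map z).esymm n‖ ≤ Cc (B + Q / p) n := by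
  have hA : 0 ≤ B + Q / p := by positivity
  induction n using Nat.strong_induction_on with
  | _ n ih =>
    rcases Nat.eq_zero_or_pos n with rfl | hn
    · simp [Cc, Multiset.esymm]
    have hn' : (0:ℝ) < n := by exact_mod_cast hn
    refine le_of_mul_le_mul_left ?_ hn'
    have := congrArg norm (newton_aeval z n)
    rw [norm_mul, norm_mul, norm_pow, norm_neg, norm_one, one_pow, one_mul] at this
    simp only [Complex.norm_natCast] at this
    rw [this]
    calc _ ≤ ∑ i ∈ Finset.range n, (B * Cc (B+Q/p) i + if p ∣ n - i then Q * Cc (B+Q/p) i else 0) := by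
          refine (norm_sum_le _ _).trans (Finset.sum_le_sum fun i hi => ?_)
          have hi' := Finset.mem_range.1 hi
          rw [norm_mul, norm_mul, norm_pow, norm_neg, norm_one, one_pow, one_mul]
          have hc := Cc_pos hA i
          split_ifs with hd
          · have := h2 (n - i) (by omega) hd
            have := mul_le_mul (ih i hi') this (norm_nonneg _) hc.le
            nlinarith
          · have := h1 (n - i) (by omega) hd
            have := mul_le_mul (ih i hi') this (norm_nonneg _) hc.le
            linarith
      _ = B * ∑ i ∈ Finset.range n, Cc (B+Q/p) i + Q/p * (p *
            ∑ i ∈ (Finset.range n).filter (fun i => p ∣ n - i), Cc (B+Q/p) i) := by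
          rw [Finset.sum_add_distrib, ← Finset.mul_sum, ← Finset.sum_filter, ← Finset.mul_sum]
          have : (p:ℝ) ≠ 0 := by positivity
          field_simp
      _ ≤ B * ∑ i ∈ Finset.range n, Cc (B+Q/p) i + Q/p * ∑ i ∈ Finset.range n, Cc (B+Q/p) i := by
          gcongr
          exact sum_mult_le hA p hp n
      _ ≤ _ := by
          rw [Cc_sum]
          have : 0 ≤ ∑ i ∈ Finset.range n, Cc (B+Q/p) i :=
            Finset.sum_nonneg fun i _ => (Cc_pos hA i).le
          linarith

section Grp
variable (F : Type*) [Field F] (m : ℕ)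

/-- units congruent to a constant modulo `X^(m+1)` -/
def Vsub : Subgroup (PowerSeries F)ˣ where
  carrier := {u | ∃ c : F, (PowerSeries.X : PowerSeries F)^(m+1) ∣ (u : PowerSeries F) - PowerSeries.C c}
  one_mem' := ⟨1, by simp⟩
  mul_mem' := by
    rintro a b ⟨c, hc⟩ ⟨d, hd⟩
    refine ⟨c * d, ?_⟩
    have : ((a * b : (PowerSeries F)ˣ) : PowerSeries F) - PowerSeries.C (c*d) =
      (a - PowerSeries.C c) * b + PowerSeries.C c * (b - PowerSeries.C d) := by
      push_cast; rw [map_mul]; ring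
    rw [this]
    exact dvd_add (hc.mul_right _) (hd.mul_left _)
  inv_mem' := by
    rintro a ⟨c, hc⟩
    have hc0 : c ≠ 0 := by
      rintro rfl
      have h1 : (PowerSeries.X : PowerSeries F) ∣ a := by
        have := (dvd_pow_self _ (Nat.succ_ne_zero m)).trans hc
        simpa using this
      exact PowerSeries.X_prime.not_isUnit (isUnit_of_dvd_unit h1 a.isUnit)
    refine ⟨c⁻¹, ?_⟩
    have : ((a⁻¹ : (PowerSeries F)ˣ) : PowerSeries F) - PowerSeries.C c⁻¹ =
      (a - PowerSeries.C c) * (-(a⁻¹ : (PowerSeries F)ˣ) * PowerSeries.C c⁻¹) := by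
      have h1 : (a : PowerSeries F) * (a⁻¹ : (PowerSeries F)ˣ) = 1 := by simp
      have h2 : (PowerSeries.C c : PowerSeries F) * PowerSeries.C c⁻¹ = 1 := by
        rw [← map_mul, mul_inv_cancel₀ hc0, map_one]
      linear_combination (-(a⁻¹ : (PowerSeries F)ˣ) : PowerSeries F) * h2 + PowerSeries.C c⁻¹ * h1
    rw [this]
    exact hc.mul_right _

def GG := (PowerSeries F)ˣ ⧸ Vsub F m

noncomputable instance : CommGroup (GG F m) :=
  inferInstanceAs (CommGroup ((PowerSeries F)ˣ ⧸ Vsub F m))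

noncomputable def mkG : (PowerSeries F)ˣ →* GG F m := QuotientGroup.mk' (Vsub F m)

variable {F} in
lemma mkG_eq {u v : (PowerSeries F)ˣ} : mkG F m u = mkG F m v ↔ u⁻¹ * v ∈ Vsub F m :=
  QuotientGroup.eq

variable {F} in
lemma mkG_eq_one {u : (PowerSeries F)ˣ} : mkG F m u = 1 ↔ u ∈ Vsub F m :=
  QuotientGroup.eq_one_iff u

variable {F}

lemma GG_eq_iff {u v : (PowerSeries F)ˣ} (hu : PowerSeries.constantCoeff (u : PowerSeries F) = 1)
    (hv : PowerSeries.constantCoeff (v : PowerSeries F) = 1) :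
    mkG F m u = mkG F m v ↔
      ∀ i ≤ m, PowerSeries.coeff i (u : PowerSeries F) = PowerSeries.coeff i (v : PowerSeries F) := by
  have key : (∀ i ≤ m, PowerSeries.coeff i (u : PowerSeries F) = PowerSeries.coeff i (v : PowerSeries F))
      ↔ (PowerSeries.X : PowerSeries F)^(m+1) ∣ (v : PowerSeries F) - u := by
    rw [PowerSeries.X_pow_dvd_iff]
    constructor
    · intro h i hi; rw [map_sub, h i (by omega), sub_self]
    · intro h i hi; have := h i (by omega); rw [map_sub, sub_eq_zero] at this; exact this.symm
  rw [key, mkG_eq]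
  have h1 : ((u⁻¹ : (PowerSeries F)ˣ) : PowerSeries F) * u = 1 := by simp
  constructor
  · rintro ⟨c, hc⟩
    have hc1 : c = 1 := by
      have h0 := (PowerSeries.X_dvd_iff).1 ((dvd_pow_self _ (Nat.succ_ne_zero m)).trans hc)
      have h2 := congrArg PowerSeries.constantCoeff h1
      push_cast at h0
      simp only [map_sub, map_mul, hu, hv, mul_one, PowerSeries.constantCoeff_C, map_one] at h0 h2
      rw [h2] at h0
      exact (sub_eq_zero.1 h0).symm
    subst hc1
    have : (v : PowerSeries F) - (u : PowerSeries F) = (u : PowerSeries F) * (((u⁻¹ * v : (PowerSeries F)ˣ) : PowerSeries F) - PowerSeries.C 1) := by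
      push_cast; rw [map_one]; linear_combination -(v : PowerSeries F) * h1
    rw [this]; exact hc.mul_left _
  · intro h
    refine ⟨1, ?_⟩
    have : (((u⁻¹ * v : (PowerSeries F)ˣ) : PowerSeries F) - PowerSeries.C 1) =
        ((u⁻¹ : (PowerSeries F)ˣ) : PowerSeries F) * ((v : PowerSeries F) - (u : PowerSeries F)) := by
      push_cast; rw [map_one]; linear_combination h1
    rw [this]; exact h.mul_left _

/-- unit from a polynomial -/
noncomputable def toU (h : F[X]) : (PowerSeries F)ˣ :=
  open Classical in
  if hh : IsUnit ((h.reverse : F[X]) : PowerSeries F) then hh.unit else 1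

lemma toU_coe {h : F[X]} (hh : h ≠ 0) : (toU h : PowerSeries F) = (h.reverse : F[X]) := by
  have : IsUnit ((h.reverse : F[X]) : PowerSeries F) := by
    rw [PowerSeries.isUnit_iff_constantCoeff]
    simp [Polynomial.coeff_zero_reverse, hh]
  unfold toU
  rw [dif_pos this]; simp

noncomputable def cls (h : F[X]) : GG F m := mkG F m (toU h)

lemma cls_mul {h₁ h₂ : F[X]} (n1 : h₁ ≠ 0) (n2 : h₂ ≠ 0) :
    cls m (h₁ * h₂) = cls m h₁ * cls m h₂ := by
  unfold cls
  rw [← map_mul]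
  congr 1
  ext1
  rw [Units.val_mul, toU_coe n1, toU_coe n2, toU_coe (mul_ne_zero n1 n2),
    Polynomial.reverse_mul_of_domain, Polynomial.coe_mul]

lemma cls_C {c : F} (hc : c ≠ 0) : cls m (C c) = 1 := by
  unfold cls
  rw [mkG_eq_one]
  refine ⟨c, ?_⟩
  rw [toU_coe (by simpa using hc)]
  simp

lemma cls_one : cls m (1 : F[X]) = 1 := by
  rw [← C_1]; exact cls_C m one_ne_zero

lemma cls_pow {h : F[X]} (n1 : h ≠ 0) (j : ℕ) : cls m (h^j) = cls m h ^ j := by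
  induction j with
  | zero => simp [cls_one]
  | succ j ih => rw [pow_succ, pow_succ, cls_mul m (pow_ne_zero _ n1) n1, ih]

lemma cls_prod {ι : Type*} (s : Finset ι) (h : ι → F[X]) (hh : ∀ i ∈ s, h i ≠ 0) :
    cls m (∏ i ∈ s, h i) = ∏ i ∈ s, cls m (h i) := by
  classical
  induction s using Finset.induction_on with
  | empty => simp [cls_one]
  | insert a s ha ih =>
    rw [Finset.prod_insert ha, Finset.prod_insert ha, cls_mul, ih]
    · exact fun i hi => hh i (Finset.mem_insert_of_mem hi)
    · exact hh a (Finset.mem_insert_self _ _)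
    · exact Finset.prod_ne_zero_iff.2 fun i hi => hh i (Finset.mem_insert_of_mem hi)

lemma toU_const {h : F[X]} (hh : h.Monic) : PowerSeries.constantCoeff (toU h : PowerSeries F) = 1 := by
  rw [toU_coe hh.ne_zero]
  simp [Polynomial.coeff_zero_reverse, hh.leadingCoeff]

lemma toU_coeff {h : F[X]} (hh : h ≠ 0) (i : ℕ) (hi : i ≤ h.natDegree) :
    PowerSeries.coeff i (toU h : PowerSeries F) = h.coeff (h.natDegree - i) := by
  rw [toU_coe hh, Polynomial.coeff_coe, Polynomial.coeff_reverse, Polynomial.revAt_le hi]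

lemma toU_coeff' {h : F[X]} (hh : h ≠ 0) (i : ℕ) (hi : h.natDegree < i) :
    PowerSeries.coeff i (toU h : PowerSeries F) = 0 := by
  rw [toU_coe hh, Polynomial.coeff_coe]
  exact Polynomial.coeff_eq_zero_of_natDegree_lt ((Polynomial.reverse_natDegree_le h).trans_lt hi)

lemma cls_eq_iff {n : ℕ} (hn : m ≤ n) {h₁ h₂ : F[X]} (m1 : h₁.Monic) (m2 : h₂.Monic)
    (d1 : h₁.natDegree = n) (d2 : h₂.natDegree = n) :
    cls m h₁ = cls m h₂ ↔ (h₁ - h₂).degree < (n - m : ℕ) := by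
  unfold cls
  rw [GG_eq_iff m (toU_const m1) (toU_const m2), Polynomial.degree_lt_iff_coeff_zero]
  constructor
  · intro h i hi
    rw [coeff_sub, sub_eq_zero]
    rcases le_or_gt i n with h3 | h3
    · have := h (n - i) (by omega)
      rw [toU_coeff m1.ne_zero _ (by omega), toU_coeff m2.ne_zero _ (by omega), d1, d2,
        show n - (n - i) = i by omega] at this
      exact this
    · rw [coeff_eq_zero_of_natDegree_lt (by omega), coeff_eq_zero_of_natDegree_lt (by omega)]
  · intro h i hi
    rw [toU_coeff m1.ne_zero _ (by omega), toU_coeff m2.ne_zero _ (by omega), d1, d2]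
    have := h (n - i) (by omega)
    rwa [coeff_sub, sub_eq_zero] at this

/-- monic polynomial with prescribed lower coefficients -/
noncomputable def mon (n : ℕ) (c : Fin n → F) : F[X] := X^n + ∑ i : Fin n, C (c i) * X^(i:ℕ)

lemma mon_deg_aux (n : ℕ) (c : Fin n → F) : (∑ i : Fin n, C (c i) * X^(i:ℕ) : F[X]).degree < (n : WithBot ℕ) := by
  refine (degree_sum_le _ _).trans_lt ?_
  refine (Finset.sup_lt_iff (WithBot.bot_lt_coe n)).2 ?_
  intro i _
  exact (degree_C_mul_X_pow_le _ _).trans_lt (WithBot.coe_lt_coe.2 i.2)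

lemma mon_monic (n : ℕ) (c : Fin n → F) : (mon n c).Monic :=
  monic_X_pow_add (mon_deg_aux n c)

lemma mon_natDegree (n : ℕ) (c : Fin n → F) : (mon n c).natDegree = n :=
  by
  refine natDegree_eq_of_degree_eq_some ?_
  unfold mon
  rw [degree_add_eq_left_of_degree_lt] <;> rw [degree_X_pow]
  exact mon_deg_aux n c

lemma mon_coeff (n : ℕ) (c : Fin n → F) (i : Fin n) : (mon n c).coeff i = c i := by
  unfold mon
  rw [coeff_add, coeff_X_pow, if_neg i.2.ne, zero_add, finsetSum_coeff]
  simp [coeff_C_mul, coeff_X_pow, Fin.ext_iff.symm]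

lemma mon_surj (n : ℕ) {h : F[X]} (hm : h.Monic) (hd : h.natDegree = n) :
    mon n (fun i => h.coeff i) = h := by
  conv_rhs => rw [hm.as_sum, hd, Finset.sum_range]
  rfl

lemma mon_inj (n : ℕ) : Function.Injective (mon (F := F) n) := by
  intro c d h
  ext i
  rw [← mon_coeff n c, ← mon_coeff n d, h]

/-- coefficient coordinates -/
lemma cls_mon_bij : Function.Bijective (fun c : Fin m → F => cls m (mon m c)) := by
  constructor
  · intro c d h
    rw [cls_eq_iff m le_rfl (mon_monic m c) (mon_monic m d) (mon_natDegree m c) (mon_natDegree m d),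
      Nat.sub_self] at h
    have h0 : mon m c - mon m d = 0 := by
      rw [← Polynomial.degree_eq_bot]; rw [← Nat.WithBot.lt_zero_iff]; exact_mod_cast h
    exact mon_inj m (sub_eq_zero.1 h0)
  · intro g
    obtain ⟨u, rfl⟩ : ∃ u, mkG F m u = g := QuotientGroup.mk_surjective g
    obtain ⟨u, hu⟩ : ∃ v : (PowerSeries F)ˣ, PowerSeries.constantCoeff (v : PowerSeries F) = 1 ∧
        mkG F m v = mkG F m u := by
      have hc : PowerSeries.constantCoeff (u : PowerSeries F) ≠ 0 :=
        (PowerSeries.isUnit_iff_constantCoeff.1 u.isUnit).ne_zero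
      refine ⟨u * toU (C (PowerSeries.constantCoeff (u : PowerSeries F))⁻¹), ?_, ?_⟩
      · rw [Units.val_mul, toU_coe (by simpa using hc), map_mul]
        simp [hc]
      · have := cls_C m (inv_ne_zero hc)
        unfold cls at this
        rw [map_mul, this, mul_one]
    refine ⟨fun i => PowerSeries.coeff (m - i) (u : PowerSeries F), ?_⟩
    rw [← hu.2]
    unfold cls
    simp only
    rw [GG_eq_iff m (toU_const (mon_monic _ _)) hu.1]
    intro i hi
    rcases Nat.eq_zero_or_pos i with rfl | hi0
    · rw [PowerSeries.coeff_zero_eq_constantCoeff, toU_const (mon_monic _ _), hu.1]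
    · rw [toU_coeff (mon_monic _ _).ne_zero _ (by rw [mon_natDegree]; exact hi), mon_natDegree]
      have := mon_coeff m (fun i => PowerSeries.coeff (m - i) (u : PowerSeries F)) ⟨m - i, by omega⟩
      simp only at this
      rw [this, show m - (m - i) = i by omega]

instance [Finite F] : Finite (GG F m) :=
  Finite.of_surjective _ (cls_mon_bij (F := F) m).2

noncomputable instance [Finite F] : Fintype (GG F m) := Fintype.ofFinite _
noncomputable instance [Finite F] : Fintype (Additive (GG F m)) := Fintype.ofFinite _

lemma card_GG [Fintype F] : Fintype.card (GG F m) = Fintype.card F ^ m := by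
  rw [← Fintype.card_of_bijective (cls_mon_bij (F := F) m)]; simp

/-- the sum of any function over monic polys of degree n ≥ m -/
lemma sum_mon [Fintype F] {n : ℕ} (hn : m ≤ n) (φ : GG F m → ℂ) :
    ∑ c : Fin n → F, φ (cls m (mon n c)) = (Fintype.card F : ℂ)^(n-m) * ∑ g, φ g := by
  classical
  obtain ⟨k, rfl⟩ := Nat.exists_eq_add_of_le' hn
  rw [Nat.add_sub_cancel]
  have e := (Fin.appendEquiv (α := F) k m)
  have hc : ∀ (a : Fin k → F) (b : Fin m → F),
      cls m (mon (k+m) (Fin.append a b)) = cls m (mon m b) := by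
    intro a b
    unfold cls
    rw [GG_eq_iff m (toU_const (mon_monic _ _)) (toU_const (mon_monic _ _))]
    intro i hi
    rcases Nat.eq_zero_or_pos i with rfl | hi0
    · rw [PowerSeries.coeff_zero_eq_constantCoeff, toU_const (mon_monic _ _), toU_const (mon_monic _ _)]
    · rw [toU_coeff (mon_monic _ _).ne_zero _ (by rw [mon_natDegree]; omega), mon_natDegree,
        toU_coeff (mon_monic _ _).ne_zero _ (by rw [mon_natDegree]; exact hi), mon_natDegree]
      have h1 := mon_coeff (k+m) (Fin.append a b) (Fin.natAdd k ⟨m - i, by omega⟩)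
      have h2 := mon_coeff m b ⟨m - i, by omega⟩
      rw [Fin.append_right] at h1
      simp only [Fin.natAdd_mk] at h1 h2
      rw [h2, ← h1]; congr 1; omega
  rw [← (Fin.appendEquiv (α := F) k m).sum_comp, Fintype.sum_prod_type]
  simp only [Fin.appendEquiv, Equiv.coe_fn_mk, hc]
  rw [Finset.sum_const, (cls_mon_bij (F := F) m).sum_comp (fun g => φ g)]
  simp
end Grp

section Fin
variable {F : Type*} [Field F]

/-- value of a character on the class of a polynomial -/
noncomputable def chi {m : ℕ} (χ : AddChar (Additive (GG F m)) ℂ) (h : F[X]) : ℂ :=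
  χ (Additive.ofMul (cls m h))

lemma chi_mul {m : ℕ} (χ : AddChar (Additive (GG F m)) ℂ) {h₁ h₂ : F[X]} (n1 : h₁ ≠ 0) (n2 : h₂ ≠ 0) :
    chi χ (h₁ * h₂) = chi χ h₁ * chi χ h₂ := by
  unfold chi; rw [cls_mul m n1 n2, ofMul_mul, AddChar.map_add_eq_mul]

lemma chi_one {m : ℕ} (χ : AddChar (Additive (GG F m)) ℂ) : chi χ (1 : F[X]) = 1 := by
  unfold chi; rw [cls_one]; simp

lemma chi_prod {m : ℕ} (χ : AddChar (Additive (GG F m)) ℂ) {ι : Type*} (s : Finset ι) (h : ι → F[X])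
    (hh : ∀ i ∈ s, h i ≠ 0) : chi χ (∏ i ∈ s, h i) = ∏ i ∈ s, chi χ (h i) := by
  classical
  induction s using Finset.induction_on with
  | empty => simp [chi_one]
  | insert a s ha ih =>
    rw [Finset.prod_insert ha, Finset.prod_insert ha, chi_mul, ih]
    · exact fun i hi => hh i (Finset.mem_insert_of_mem hi)
    · exact hh a (Finset.mem_insert_self _ _)
    · exact Finset.prod_ne_zero_iff.2 fun i hi => hh i (Finset.mem_insert_of_mem hi)

variable [Fintype F]

lemma chi_norm {m : ℕ} (χ : AddChar (Additive (GG F m)) ℂ) (h : F[X]) : ‖chi χ h‖ = 1 :=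
  AddChar.norm_apply _ _

variable [DecidableEq F]

lemma count_eq (k m : ℕ) (hk : 1 ≤ k) (f : F[X]) (hf : f.natDegree = k + m) :
    Nat.card {g : F[X] // g.degree < (k : ℕ) ∧
          (Finset.univ.filter (fun a : F => (f + g).eval a = 0)).card = k + m} =
    Nat.card {S : Finset F // S ∈ Finset.univ.powersetCard (k+m) ∧ cls m (∏ a ∈ S, (X - C a)) = cls m f} := by
  have hf0 : f ≠ 0 := by rintro rfl; simp at hf; omega
  set c := f.leadingCoeff with hc
  have hc0 : c ≠ 0 := by simpa [hc] using hf0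
  have hm1 : (C c⁻¹ * f).Monic := by
    rw [Monic, leadingCoeff_mul, leadingCoeff_C, ← hc, inv_mul_cancel₀ hc0]
  have hd1 : (C c⁻¹ * f).natDegree = k + m := by rw [natDegree_C_mul (inv_ne_zero hc0), hf]
  have hcl : cls m (C c⁻¹ * f) = cls m f := by
    rw [cls_mul m (by simpa using hc0) hf0, cls_C m (inv_ne_zero hc0), one_mul]
  have hmS : ∀ S : Finset F, (∏ a ∈ S, (X - C a)).Monic := fun S => monic_prod_of_monic _ _ fun a _ => monic_X_sub_C a
  have hdS : ∀ S : Finset F, (∏ a ∈ S, (X - C a)).natDegree = S.card := fun S => by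
    rw [natDegree_prod_of_monic _ _ fun a _ => monic_X_sub_C a]; simp
  have hCC : C c * C c⁻¹ = 1 := by rw [← C_mul, mul_inv_cancel₀ hc0, C_1]
  have fact : ∀ g : F[X], g.degree < (k:ℕ) →
      (Finset.univ.filter (fun a : F => (f + g).eval a = 0)).card = k + m →
      f + g = C c * ∏ a ∈ Finset.univ.filter (fun a : F => (f + g).eval a = 0), (X - C a) := by
    intro g hg hS
    set S := Finset.univ.filter (fun a : F => (f + g).eval a = 0) with hSdef
    have hgf : g.degree < f.degree := by
      rw [degree_eq_natDegree hf0, hf]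
      exact hg.trans_le (by exact_mod_cast Nat.le_add_right k m)
    have hdvd : ∏ a ∈ S, (X - C a) ∣ f + g := by
      refine Finset.prod_dvd_of_coprime ?_ ?_
      · intro a _ b _ hab
        exact isCoprime_X_sub_C_of_isUnit_sub (sub_ne_zero.2 hab).isUnit
      · intro a ha
        exact dvd_iff_isRoot.2 (Finset.mem_filter.1 ha).2
    have hlc : (f+g).leadingCoeff = c := leadingCoeff_add_of_degree_lt' hgf
    have hdeg : (f+g).natDegree = k+m := by rw [natDegree_add_eq_left_of_degree_lt hgf, hf]
    obtain ⟨r, hr⟩ := hdvd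
    have hfg0 : f + g ≠ 0 := by intro h; rw [h] at hdeg; simp at hdeg; omega
    have hr0 : r ≠ 0 := by rintro rfl; simp at hr; exact hfg0 hr
    have hrd : r.natDegree = 0 := by
      have := congrArg natDegree hr
      rw [natDegree_mul (hmS S).ne_zero hr0, hdS, hdeg, hS] at this
      omega
    obtain ⟨d, rfl⟩ := natDegree_eq_zero.1 hrd
    have := congrArg leadingCoeff hr
    rw [leadingCoeff_mul, (hmS S).leadingCoeff, hlc, leadingCoeff_C, one_mul] at this
    rw [hr, this, mul_comm]
  refine Nat.card_eq_of_bijective (fun g => ⟨Finset.univ.filter (fun a : F => (f + g.1).eval a = 0), ?_, ?_⟩) ⟨?_, ?_⟩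
  · simpa [Finset.mem_powersetCard] using g.2.2
  · have h1 := fact g.1 g.2.1 g.2.2
    rw [← hcl, cls_eq_iff m (Nat.le_add_left m k) (hmS _) hm1 (by rw [hdS, g.2.2]) hd1, Nat.add_sub_cancel]
    have : ∏ a ∈ Finset.univ.filter (fun a : F => (f + g.1).eval a = 0), (X - C a) - C c⁻¹ * f = C c⁻¹ * g.1 := by
      have h2 : C c⁻¹ * (f + g.1) = _ := congrArg (fun x => C c⁻¹ * x) h1
      rw [← mul_assoc, mul_comm (C c⁻¹) (C c), hCC, one_mul, mul_add] at h2
      rw [← h2]; ring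
    rw [this, degree_C_mul (inv_ne_zero hc0)]
    exact g.2.1
  · rintro ⟨g, hg1, hg2⟩ ⟨g', hg1', hg2'⟩ h
    have h' := congrArg Subtype.val h
    simp only at h'
    have e1 := fact g hg1 hg2
    have e2 := fact g' hg1' hg2'
    rw [h', ← e2] at e1
    exact Subtype.ext (add_left_cancel e1)
  · rintro ⟨S, hS1, hS2⟩
    have hcard := (Finset.mem_powersetCard.1 hS1).2
    rw [← hcl, cls_eq_iff m (Nat.le_add_left m k) (hmS _) hm1 (by rw [hdS, hcard]) hd1, Nat.add_sub_cancel] at hS2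
    have hfil : Finset.univ.filter (fun a : F => (f + (C c * ∏ a ∈ S, (X - C a) - f)).eval a = 0) = S := by
      ext a
      rw [Finset.mem_filter, add_sub_cancel, eval_mul, eval_C, eval_prod]
      simp [hc0, Finset.prod_eq_zero_iff, sub_eq_zero]
    refine ⟨⟨C c * ∏ a ∈ S, (X - C a) - f, ?_, ?_⟩, ?_⟩
    · have : C c * ∏ a ∈ S, (X - C a) - f = C c * (∏ a ∈ S, (X - C a) - C c⁻¹ * f) := by
        rw [mul_sub, ← mul_assoc (C c) (C c⁻¹), hCC, one_mul]
      rw [this, degree_C_mul hc0]; exact hS2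
    · rw [hfil, hcard]
    · exact Subtype.ext hfil

lemma chi_sum_eq {m : ℕ} (h₁ h₂ : F[X]) :
    ∑ χ : AddChar (Additive (GG F m)) ℂ, chi χ h₁ * (chi χ h₂)⁻¹ =
      open Classical in if cls m h₁ = cls m h₂ then (Fintype.card F : ℂ)^m else 0 := by
  classical
  have h := AddChar.sum_apply_eq_ite (Additive.ofMul (cls m h₁) - Additive.ofMul (cls m h₂))
  simp only [sub_eq_zero, Additive.ofMul.apply_eq_iff_eq] at h
  have hc : Fintype.card (Additive (GG F m)) = Fintype.card F ^ m := by
    rw [← card_GG]; exact Fintype.card_congr Additive.toMul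
  rw [hc] at h
  push_cast at h
  refine Eq.trans (Finset.sum_congr rfl fun χ _ => ?_) (h.trans ?_)
  · unfold chi
    rw [AddChar.map_sub_eq_div, div_eq_mul_inv]
  · congr

theorem final_of_weil (q p : ℕ) (hcard : Fintype.card F = q) [hp : Fact p.Prime] [CharP F p]
    (k m : ℕ) (hk : 1 ≤ k)
    (f : Polynomial F) (hf : f.natDegree = k + m)
    (weil : ∀ χ : AddChar (Additive (GG F m)) ℂ, χ ≠ 0 → ‖∑ a : F, chi χ (X - C a)‖ ≤ m * Real.sqrt q) :
    |(Nat.card {g : Polynomial F // g.degree < (k : ℕ) ∧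
          (Finset.univ.filter (fun a : F => (f + g).eval a = 0)).card = k + m} : ℝ)
        - ((q : ℝ) ^ m)⁻¹ * (q.choose (k + m) : ℝ)|
      ≤ gchoose ((q : ℝ) / (p : ℝ) + (m : ℝ) * Real.sqrt q + (k : ℝ) + (m : ℝ))
          ((k : ℝ) + (m : ℝ)) := by
  classical
  have hA : 0 ≤ (m : ℝ) * Real.sqrt q + q / p := by positivity
  have e1 : gchoose ((q : ℝ) / (p : ℝ) + (m : ℝ) * Real.sqrt q + (k : ℝ) + (m : ℝ)) ((k : ℝ) + (m : ℝ))
      = Cc ((m : ℝ) * Real.sqrt q + q / p) (k+m) := by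
    rw [← gchoose_eq hA]; push_cast; congr 1; ring
  rw [e1, count_eq k m hk f hf]
  set n := k + m with hn
  set Cn := Cc ((m : ℝ) * Real.sqrt q + q / p) n with hCn
  have hCn0 : 0 < Cn := Cc_pos hA n
  have hq0 : (q:ℂ) ≠ 0 := by
    rw [← hcard]; exact_mod_cast Fintype.card_ne_zero
  have hqr : (0:ℝ) < q := by
    rw [← hcard]; exact_mod_cast Fintype.card_pos
  set E : AddChar (Additive (GG F m)) ℂ → ℂ := fun χ =>
    (Finset.univ.val.map (fun a : F => chi χ (X - C a))).esymm n with hE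
  have key : (q:ℂ)^m * (Nat.card {S : Finset F // S ∈ Finset.univ.powersetCard n ∧
      cls m (∏ a ∈ S, (X - C a)) = cls m f} : ℂ) = ∑ χ, E χ * (chi χ f)⁻¹ := by
    rw [Nat.card_eq_fintype_card, Fintype.card_subtype, ← Finset.sum_boole]
    simp only [hE, Finset.esymm_map_val]
    simp_rw [Finset.sum_mul]
    rw [Finset.sum_comm, Finset.mul_sum]
    have : ∀ S : Finset F, ∑ χ : AddChar (Additive (GG F m)) ℂ, (∏ a ∈ S, chi χ (X - C a)) * (chi χ f)⁻¹
        = if cls m (∏ a ∈ S, (X - C a)) = cls m f then (q:ℂ)^m else 0 := by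
      intro S
      rw [← hcard, ← chi_sum_eq]
      refine Finset.sum_congr rfl fun χ _ => ?_
      rw [chi_prod _ _ _ fun a _ => X_sub_C_ne_zero a]
    simp_rw [this]
    rw [← Finset.filter_univ_mem (Finset.powersetCard n Finset.univ), Finset.sum_filter]
    refine Finset.sum_congr rfl fun S _ => ?_
    by_cases h1 : S ∈ Finset.powersetCard n (Finset.univ : Finset F) <;>
      by_cases h2 : cls m (∏ a ∈ S, (X - C a)) = cls m f <;> simp [h1, h2]
  have hE0 : E 0 * (chi (0 : AddChar (Additive (GG F m)) ℂ) f)⁻¹ = q.choose n := by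
    simp only [hE, Finset.esymm_map_val, chi, AddChar.zero_apply]
    simp [Finset.card_powersetCard, hcard]
  have hEb : ∀ χ : AddChar (Additive (GG F m)) ℂ, χ ≠ 0 → ‖E χ * (chi χ f)⁻¹‖ ≤ Cn := by
    intro χ hχ
    rw [norm_mul, norm_inv, chi_norm, inv_one, mul_one]
    refine esymm_bound _ p hp.out.pos _ q (by positivity) (by positivity) ?_ ?_ n
    · intro j hj hpj
      have : ∀ a : F, chi χ (X - C a) ^ j = chi (j • χ) (X - C a) := fun a => by
        unfold chi; rw [AddChar.nsmul_apply]
      simp_rw [this]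
      refine weil _ fun h0 => hχ ?_
      have hord : addOrderOf χ ∣ q ^ m := by
        have hcar : Nat.card (Additive (GG F m)) = q^m := by
          rw [← hcard, ← card_GG, ← Nat.card_eq_fintype_card]; rfl
        refine addOrderOf_dvd_of_nsmul_eq_zero ?_
        ext a
        rw [AddChar.nsmul_apply, AddChar.zero_apply, ← AddChar.map_nsmul_eq_pow, ← hcar, card_nsmul_eq_zero', AddChar.map_zero_eq_one]
      have hord2 : addOrderOf χ ∣ j := addOrderOf_dvd_of_nsmul_eq_zero h0
      obtain ⟨r, _, hr⟩ := FiniteField.card F p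
      rw [hcard] at hr
      rw [hr, ← pow_mul] at hord
      have hcop : Nat.Coprime (p ^ (↑r * m)) j := ((Nat.Prime.coprime_iff_not_dvd hp.out).2 hpj).pow_left _
      have := Nat.dvd_gcd hord hord2
      rw [hcop.gcd_eq_one, Nat.dvd_one, AddMonoid.addOrderOf_eq_one_iff] at this
      exact this
    · intro j hj _
      refine (norm_sum_le _ _).trans ?_
      simp [chi_norm, hcard]
  have hsplit : ∑ χ, E χ * (chi χ f)⁻¹ = q.choose n + ∑ χ ∈ Finset.univ.erase 0, E χ * (chi χ f)⁻¹ := by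
    rw [← Finset.add_sum_erase _ _ (Finset.mem_univ 0), hE0]
  rw [hsplit] at key
  have hb : ‖∑ χ ∈ Finset.univ.erase 0, E χ * (chi χ f)⁻¹‖ ≤ (q:ℝ)^m * Cn := by
    refine (norm_sum_le_of_le _ fun χ hχ => hEb χ (Finset.ne_of_mem_erase hχ)).trans ?_
    rw [Finset.sum_const, nsmul_eq_mul]
    refine mul_le_mul_of_nonneg_right ?_ hCn0.le
    have : (Finset.univ.erase (0 : AddChar (Additive (GG F m)) ℂ)).card ≤ q^m := by
      refine (Finset.card_erase_le).trans ?_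
      have : Fintype.card (Additive (GG F m)) = q ^ m := by
        rw [← hcard, ← card_GG]; exact Fintype.card_congr Additive.toMul
      rw [Finset.card_univ, ← this, AddChar.card_eq]
    exact_mod_cast this
  set N := Nat.card {S : Finset F // S ∈ Finset.univ.powersetCard n ∧
      cls m (∏ a ∈ S, (X - C a)) = cls m f}
  have h3 : ‖((q:ℂ)^m * N - q.choose n)‖ ≤ (q:ℝ)^m * Cn := by
    rw [key, add_sub_cancel_left]; exact hb
  have h4 : ((q:ℂ)^m * N - q.choose n) = (((q:ℝ)^m * ((N:ℝ) - ((q:ℝ)^m)⁻¹ * q.choose n) : ℝ) : ℂ) := by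
    push_cast; field_simp
  rw [h4, Complex.norm_real, norm_mul, Real.norm_eq_abs, Real.norm_eq_abs, abs_of_pos (by positivity)] at h3
  exact le_of_mul_le_mul_left h3 (by positivity)
end Fin

section Lfun
variable {F : Type*} [Field F] [Fintype F]

local notation "K" => AlgebraicClosure F
local notation "q" => Fintype.card F

lemma fixed_in_base {x : K} (hx : x ^ q = x) : x ∈ Set.range (algebraMap F K) := by
  have h1 : (X^q - X : F[X]) = ∏ a : F, (X - C a) := by
    have h2 := FiniteField.roots_X_pow_card_sub_X F
    have h3 : (X^q - X : F[X]).Monic := by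
      refine monic_X_pow_sub ?_
      rw [degree_X]; exact_mod_cast Fintype.one_lt_card (α := F)
    have := prod_multiset_X_sub_C_of_monic_of_roots_card_eq h3 (by
      rw [h2, FiniteField.X_pow_card_sub_X_natDegree_eq F Fintype.one_lt_card]; rfl)
    rw [h2] at this
    exact this.symm
  have h2 := congrArg (fun p => (p.map (algebraMap F K)).eval x) h1
  simp only [Polynomial.map_sub, Polynomial.map_pow, map_X, Polynomial.map_prod, map_C, eval_sub, eval_pow,
    eval_X, eval_prod, eval_C, hx, sub_self] at h2
  obtain ⟨a, _, ha⟩ := Finset.prod_eq_zero_iff.1 h2.symm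
  exact ⟨a, (sub_eq_zero.1 ha).symm⟩

lemma frobK_inj : Function.Injective (fun x : K => x ^ q) :=
  (FiniteField.frobeniusAlgHom F K).toRingHom.injective

noncomputable def QK (i : ℕ) (a : K) : K[X] := ∏ j ∈ Finset.range i, (X - C (a ^ q ^ j))

lemma QK_monic (i : ℕ) (a : K) : (QK i a).Monic := monic_prod_of_monic _ _ fun _ _ => monic_X_sub_C _

lemma QK_natDegree (i : ℕ) (a : K) : (QK i a).natDegree = i := by
  unfold QK
  rw [natDegree_prod_of_monic _ _ fun _ _ => monic_X_sub_C _]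
  simp only [natDegree_X_sub_C]; simp

lemma QK_frob {i : ℕ} {a : K} (ha : a ^ q ^ i = a) :
    (QK i a).map (FiniteField.frobeniusAlgHom F K : K →+* K) = QK i a := by
  unfold QK
  rw [Polynomial.map_prod]
  simp only [Polynomial.map_sub, map_X, map_C]
  have : ∀ j, (FiniteField.frobeniusAlgHom F K : K →+* K) (a ^ q ^ j) = a ^ q ^ (j+1) := fun j => by
    change (a ^ q ^ j)^q = _
    rw [← pow_mul, pow_succ]
  simp only [this]
  cases i with
  | zero => simp
  | succ i =>
    rw [Finset.prod_range_succ, ha, Finset.prod_range_succ']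
    simp

lemma QF_exists {i : ℕ} {a : K} (ha : a ^ q ^ i = a) : ∃ h : F[X], h.map (algebraMap F K) = QK i a := by
  have : QK i a ∈ lifts (algebraMap F K) := by
    rw [lifts_iff_coeff_lifts]
    intro n
    apply fixed_in_base
    conv_rhs => rw [← QK_frob ha, coeff_map]
    rfl
  exact this

open Classical in
noncomputable def QF (i : ℕ) (a : K) : F[X] :=
  if ha : a ^ q ^ i = a then (QF_exists ha).choose else 1

lemma QF_map {i : ℕ} {a : K} (ha : a ^ q ^ i = a) : (QF i a).map (algebraMap F K) = QK i a := by
  unfold QF; rw [dif_pos ha]; exact (QF_exists ha).choose_spec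

lemma QF_monic {i : ℕ} {a : K} (ha : a ^ q ^ i = a) : (QF i a).Monic := by
  have := QK_monic i a
  rw [← QF_map ha] at this
  exact (monic_map_iff).1 this

lemma QF_natDegree {i : ℕ} {a : K} (ha : a ^ q ^ i = a) : (QF i a).natDegree = i := by
  have := QK_natDegree i a
  rwa [← QF_map ha, natDegree_map] at this

noncomputable def Fi (F : Type*) [Field F] [Fintype F] (i : ℕ) : Finset (AlgebraicClosure F) :=
  open Classical in (X ^ (Fintype.card F)^i - X : (AlgebraicClosure F)[X]).roots.toFinset

lemma mem_Fi {i : ℕ} (hi : i ≠ 0) {a : K} : a ∈ Fi F i ↔ a ^ q ^ i = a := by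
  classical
  unfold Fi
  rw [Multiset.mem_toFinset, mem_roots (FiniteField.X_pow_card_pow_sub_X_ne_zero K hi Fintype.one_lt_card)]
  simp [sub_eq_zero]

lemma card_Fi {i : ℕ} (hi : i ≠ 0) : (Fi F i).card = q ^ i := by
  obtain ⟨p, hp⟩ := CharP.exists F
  have := hp
  obtain ⟨r, hpp, hr⟩ := FiniteField.card F p
  have : CharP K p := charP_of_injective_algebraMap (algebraMap F K).injective p
  have hs : (X ^ q^i - X : K[X]).Separable := by
    refine galois_poly_separable p _ ?_
    rw [hr, ← pow_mul]
    exact dvd_pow_self _ (mul_ne_zero r.ne_zero hi)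
  classical
  unfold Fi
  rw [Multiset.toFinset_card_of_nodup (nodup_roots hs), splits_iff_card_roots.1 (IsAlgClosed.splits _),
    FiniteField.X_pow_card_pow_sub_X_natDegree_eq K hi Fintype.one_lt_card]

lemma dvd_frob {h : F[X]} {a : K} {j : ℕ} (hd : (X - C a)^j ∣ h.map (algebraMap F K)) (i : ℕ) :
    (X - C (a ^ q ^ i))^j ∣ h.map (algebraMap F K) := by
  induction i with
  | zero => simpa using hd
  | succ i ih =>
    obtain ⟨r, hr⟩ := ih
    have := congrArg (Polynomial.map (FiniteField.frobeniusAlgHom F K : K →+* K)) hr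
    rw [Polynomial.map_mul, Polynomial.map_pow, Polynomial.map_sub, map_X, map_C, Polynomial.map_map,
      AlgHom.comp_algebraMap] at this
    rw [this]
    have e : (FiniteField.frobeniusAlgHom F K : K →+* K) (a ^ q ^ i) = a ^ q ^ (i+1) := by
      change (a ^ q ^ i)^q = _
      rw [← pow_mul, pow_succ]
    rw [e]
    exact dvd_mul_right _ _

lemma QK_mul {d : ℕ} {a : K} (ha : a ^ q ^ d = a) (j : ℕ) : QK (j * d) a = QK d a ^ j := by
  induction j with
  | zero => simp [QK]
  | succ j ih =>
    rw [Nat.succ_mul, add_comm, pow_succ', ← ih]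
    unfold QK
    rw [Finset.prod_range_add]
    congr 1
    refine Finset.prod_congr rfl fun x _ => ?_
    rw [pow_add, pow_mul, ha]

lemma root_count {n : ℕ} {h : F[X]} (hm : h.Monic) (hn : h.natDegree = n) {a : K} 
    (ha : a ∈ (h.map (algebraMap F K)).roots) [DecidablePred fun i => a ^ q ^ i = a ∧ QK i a ∣ h.map (algebraMap F K)] :
    ((Finset.Icc 1 n).filter (fun i => a ^ q ^ i = a ∧ QK i a ∣ h.map (algebraMap F K))).card =
      (h.map (algebraMap F K)).rootMultiplicity a := by
  have hK0 : h.map (algebraMap F K) ≠ 0 := (hm.map _).ne_zero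
  have hit : ∀ i, (fun x : K => x ^ q)^[i] a = a ^ q ^ i := fun i => by rw [pow_iterate]
  have hroot : ∀ i : ℕ, a ^ q ^ i ∈ (h.map (algebraMap F K)).roots := by
    intro i
    rw [mem_roots hK0, ← dvd_iff_isRoot] at ha ⊢
    have := dvd_frob (j := 1) (h := h) (a := a) (by simpa using ha) i
    simpa using this
  set d := Function.minimalPeriod (fun x : K => x ^ q) a with hd
  have hd0 : 0 < d := by
    apply Function.minimalPeriod_pos_of_mem_periodicPts
    classical
    have : ¬ Function.Injective (fun i : ℕ => (⟨a ^ q ^ i, by simpa using hroot i⟩ : (h.map (algebraMap F K)).roots.toFinset)) :=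
      not_injective_infinite_finite _
    unfold Function.Injective at this
    push Not at this
    obtain ⟨i, j, hij', hne⟩ := this
    have hij := congrArg Subtype.val hij'
    simp only [← hit] at hij
    wlog hlt : i < j generalizing i j
    · exact this j i hij'.symm hne.symm hij.symm (by omega)
    exact ⟨j - i, by omega, Function.iterate_cancel frobK_inj hij.symm⟩
  have hper : ∀ i, a ^ q ^ i = a ↔ d ∣ i := by
    intro i
    rw [hd, ← Function.isPeriodicPt_iff_minimalPeriod_dvd, Function.IsPeriodicPt, Function.IsFixedPt, hit]
  have had := (hper d).2 dvd_rfl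
  have hdv : ∀ j : ℕ, QK (j * d) a ∣ h.map (algebraMap F K) ↔ j ≤ (h.map (algebraMap F K)).rootMultiplicity a := by
    intro j
    rw [le_rootMultiplicity_iff hK0, QK_mul had]
    constructor
    · intro hh
      refine (pow_dvd_pow_of_dvd ?_ j).trans hh
      have := Finset.dvd_prod_of_mem (fun j => X - C (a ^ q ^ j)) (Finset.mem_range.2 hd0)
      simpa [QK] using this
    · intro hh
      unfold QK
      rw [← Finset.prod_pow]
      refine Finset.prod_dvd_of_coprime ?_ fun i _ => dvd_frob hh i
      intro i hi j hj hij
      refine IsCoprime.pow (isCoprime_X_sub_C_of_isUnit_sub (sub_ne_zero.2 fun he => hij ?_).isUnit)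
      refine Function.iterate_injOn_Iio_minimalPeriod (f := fun x : K => x ^ q) (x := a) ?_ ?_ ?_
      · simpa using hi
      · simpa using hj
      · simp only [hit]; exact he
  have : (Finset.Icc 1 n).filter (fun i => a ^ q ^ i = a ∧ QK i a ∣ h.map (algebraMap F K)) =
      (Finset.Icc 1 ((h.map (algebraMap F K)).rootMultiplicity a)).image (fun j => j * d) := by
    ext i
    simp only [Finset.mem_filter, Finset.mem_Icc, Finset.mem_image, hper]
    constructor
    · rintro ⟨⟨h1, h2⟩, ⟨j, rfl⟩, h4⟩
      rw [mul_comm] at h4 h1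
      refine ⟨j, ⟨?_, (hdv j).1 h4⟩, mul_comm _ _⟩
      rcases Nat.eq_zero_or_pos j with rfl | hj
      · simp at h1
      · exact hj
    · rintro ⟨j, ⟨h1, h2⟩, rfl⟩
      have h3 := (hdv j).2 h2
      refine ⟨⟨Nat.mul_pos h1 hd0, ?_⟩, Dvd.intro_left j rfl, h3⟩
      have := natDegree_le_of_dvd h3 hK0
      rwa [QK_natDegree, natDegree_map, hn] at this
  rw [this, Finset.card_image_of_injective _ (fun x y hxy => Nat.eq_of_mul_eq_mul_right hd0 hxy)]
  simp

open Classical in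
lemma total_count {n : ℕ} {h : F[X]} (hm : h.Monic) (hn : h.natDegree = n) :
    ∑ i ∈ Finset.Icc 1 n, ((Fi F i).filter (fun a => QF i a ∣ h)).card = n := by
  have hK0 : h.map (algebraMap F K) ≠ 0 := (hm.map _).ne_zero
  set R := (h.map (algebraMap F K)).roots.toFinset with hR
  have e : ∀ i ∈ Finset.Icc 1 n, ((Fi F i).filter (fun a => QF i a ∣ h)) =
      R.filter (fun a => a ^ q ^ i = a ∧ QK i a ∣ h.map (algebraMap F K)) := by
    intro i hi
    have hi1 := (Finset.mem_Icc.1 hi).1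
    ext a
    rw [Finset.mem_filter, Finset.mem_filter, mem_Fi (by omega)]
    constructor
    · rintro ⟨h1, h2⟩
      have h3 : QK i a ∣ h.map (algebraMap F K) := by rw [← QF_map h1]; exact Polynomial.map_dvd _ h2
      refine ⟨?_, h1, h3⟩
      rw [hR, Multiset.mem_toFinset, mem_roots hK0, ← dvd_iff_isRoot]
      refine Dvd.dvd.trans ?_ h3
      have := Finset.dvd_prod_of_mem (fun j => X - C (a ^ q ^ j)) (Finset.mem_range.2 hi1)
      simpa [QK] using this
    · rintro ⟨_, h1, h3⟩
      refine ⟨h1, ?_⟩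
      rw [← QF_map h1, map_dvd_map'] at h3
      exact h3
  rw [Finset.sum_congr rfl fun i hi => by rw [e i hi]]
  simp_rw [Finset.card_filter]
  rw [Finset.sum_comm]
  simp_rw [← Finset.card_filter]
  rw [Finset.sum_congr rfl fun a ha => root_count hm hn (Multiset.mem_toFinset.1 ha)]
  simp_rw [← count_roots]
  rw [Multiset.toFinset_sum_count_eq, splits_iff_card_roots.1 (IsAlgClosed.splits _), natDegree_map, hn]

noncomputable def cn {m : ℕ} (χ : AddChar (Additive (GG F m)) ℂ) (n : ℕ) : ℂ := ∑ c : Fin n → F, chi χ (mon n c)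
noncomputable def Sn {m : ℕ} (χ : AddChar (Additive (GG F m)) ℂ) (i : ℕ) : ℂ := ∑ a ∈ Fi F i, chi χ (QF i a)

lemma cn_zero {m : ℕ} (χ : AddChar (Additive (GG F m)) ℂ) : cn χ 0 = 1 := by
  simp [cn, mon, chi_one]

lemma cn_eq_zero {m : ℕ} {χ : AddChar (Additive (GG F m)) ℂ} (hχ : χ ≠ 0) {n : ℕ} (hn : m ≤ n) : cn χ n = 0 := by
  unfold cn chi
  rw [sum_mon m hn (fun g => χ (Additive.ofMul g))]
  have h := AddChar.sum_eq_zero_iff_ne_zero.2 hχ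
  have e : ∑ g : GG F m, χ (Additive.ofMul g) = ∑ x, χ x :=
    Fintype.sum_equiv Additive.ofMul _ _ fun _ => rfl
  rw [e, h, mul_zero]

lemma L_newton {m : ℕ} (χ : AddChar (Additive (GG F m)) ℂ) (n : ℕ) :
    (n:ℂ) * cn χ n = ∑ i ∈ Finset.Icc 1 n, Sn χ i * cn χ (n - i) := by
  classical
  have h1 : ∀ i ∈ Finset.Icc 1 n, Sn χ i * cn χ (n-i) =
      ∑ a ∈ Fi F i, ∑ c : Fin n → F, if QF i a ∣ mon n c then chi χ (mon n c) else 0 := by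
    intro i hi
    obtain ⟨hi1, hi2⟩ := Finset.mem_Icc.1 hi
    unfold Sn
    rw [Finset.sum_mul]
    refine Finset.sum_congr rfl fun a ha => ?_
    rw [mem_Fi (by omega)] at ha
    unfold cn
    rw [Finset.mul_sum, ← Finset.sum_filter]
    have hb : ∀ c : Fin (n-i) → F, mon n (fun j => (QF i a * mon (n-i) c).coeff j) = QF i a * mon (n-i) c := by
      intro c
      refine mon_surj n ((QF_monic ha).mul (mon_monic _ _)) ?_
      rw [(QF_monic ha).natDegree_mul (mon_monic _ _), QF_natDegree ha, mon_natDegree]; omega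
    refine Finset.sum_bij (fun c _ => fun j : Fin n => (QF i a * mon (n-i) c).coeff j) ?_ ?_ ?_ ?_
    · intro c _
      rw [Finset.mem_filter, hb]
      exact ⟨Finset.mem_univ _, dvd_mul_right _ _⟩
    · intro c _ c' _ h
      have := congrArg (mon n) h
      simp only [hb] at this
      exact mon_inj _ (mul_left_cancel₀ (QF_monic ha).ne_zero this)
    · intro c hc
      obtain ⟨r, hr⟩ := (Finset.mem_filter.1 hc).2
      have hrm : r.Monic := (QF_monic ha).of_mul_monic_left (hr ▸ mon_monic n c)
      have hrd : r.natDegree = n - i := by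
        have := congrArg natDegree hr
        rw [(QF_monic ha).natDegree_mul hrm, QF_natDegree ha, mon_natDegree] at this; omega
      refine ⟨fun j => r.coeff j, Finset.mem_univ _, ?_⟩
      apply mon_inj n
      rw [hb, mon_surj _ hrm hrd, hr]
    · intro c _
      rw [hb, chi_mul _ (QF_monic ha).ne_zero (mon_monic _ _).ne_zero]
  rw [Finset.sum_congr rfl h1]
  simp_rw [Finset.sum_comm (s := Fi F _)]
  rw [Finset.sum_comm]
  unfold cn
  rw [Finset.mul_sum]
  refine Finset.sum_congr rfl fun c _ => ?_
  simp_rw [← Finset.sum_filter, Finset.sum_const, nsmul_eq_mul]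
  rw [← Finset.sum_mul, ← Nat.cast_sum, total_count (mon_monic n c) (mon_natDegree n c)]

lemma Sn_one {m : ℕ} (χ : AddChar (Additive (GG F m)) ℂ) : Sn χ 1 = ∑ a : F, chi χ (X - C a) := by
  have h := L_newton χ 1
  simp only [Nat.cast_one, one_mul, Finset.Icc_self, Finset.sum_singleton, Nat.sub_self, cn_zero, mul_one] at h
  rw [← h]
  unfold cn
  refine Fintype.sum_equiv ((Equiv.funUnique (Fin 1) F).trans (Equiv.neg F)) _ _ fun c => ?_
  simp [mon]

end Lfun

lemma recur {σ : Type*} [Fintype σ] (u : σ → ℂ) (hu : ∀ x, ‖u x‖ = 1) (N : ℕ) :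
    ∃ t, N ≤ t ∧ ∀ x, ‖u x ^ t - 1‖ < 1/2 := by
  have hc : IsCompact (Metric.closedBall (0 : σ → ℂ) 1) := isCompact_closedBall _ _
  obtain ⟨a, -, φ, hφ, hlim⟩ := hc.tendsto_subseq (x := fun n : ℕ => fun x => u x ^ n) (by
    intro n
    rw [mem_closedBall_zero_iff, pi_norm_le_iff_of_nonneg zero_le_one]
    intro x; simp [hu])
  have hC := hlim.cauchySeq
  rw [Metric.cauchySeq_iff] at hC
  obtain ⟨M, hM⟩ := hC (1/2) (by norm_num)
  have hge : φ M + N ≤ φ (M + N) := by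
    clear hM
    induction N with
    | zero => simp
    | succ N ih => have := hφ (show M + N < M + (N+1) by omega); omega
  refine ⟨φ (M+N) - φ M, by omega, fun x => ?_⟩
  have h1 := hM (M+N) (by omega) M le_rfl
  have h2 := (dist_le_pi_dist _ _ x).trans_lt h1
  simp only [Function.comp, dist_eq_norm] at h2
  have h3 : u x ^ φ (M+N) = u x ^ (φ (M+N) - φ M) * u x ^ φ M := by rw [← pow_add]; congr 1; omega
  rw [h3, ← sub_one_mul, norm_mul, norm_pow, hu, one_pow, mul_one] at h2
  exact h2

lemma compact_bound {σ : Type*} [Fintype σ] (z : σ → ℂ) (R C : ℝ) (hR : 0 < R) (T : ℕ)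
    (h : ∀ t, T ≤ t → ‖∑ x, z x ^ t‖ ≤ C * R ^ t) (x : σ) : ‖z x‖ ≤ R := by
  by_contra hlt
  push Not at hlt
  have h1 : 1 < ‖z x‖ / R := by rw [lt_div_iff₀ hR]; simpa using hlt
  obtain ⟨N, hN⟩ := ((tendsto_pow_atTop_atTop_of_one_lt h1).eventually_gt_atTop (2*C)).exists_forall_of_atTop
  set u : σ → ℂ := fun y => if z y = 0 then 1 else z y / ‖z y‖ with hu
  have hu1 : ∀ y, ‖u y‖ = 1 := by
    intro y; simp only [hu]; split_ifs with h0
    · simp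
    · simp [h0]
  obtain ⟨t, ht, hn⟩ := recur u hu1 (N + T + 1)
  have hre : ∀ y, ‖z y‖^t / 2 ≤ (z y ^ t).re := by
    intro y
    have e : z y = (‖z y‖ : ℂ) * u y := by
      simp only [hu]; split_ifs with h0
      · simp [h0]
      · field_simp [h0]
    have h2 : 1/2 ≤ (u y ^ t).re := by
      have := (Complex.abs_re_le_norm _).trans_lt (hn y)
      rw [Complex.sub_re, Complex.one_re, abs_lt] at this
      linarith
    have h3 : (z y ^ t).re = ‖z y‖^t * (u y ^ t).re := by
      conv_lhs => rw [e]
      rw [mul_pow, ← Complex.ofReal_pow, Complex.re_ofReal_mul]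
    rw [h3]
    have : 0 ≤ ‖z y‖^t := by positivity
    nlinarith
  have h4 : ‖z x‖^t / 2 ≤ C * R^t := by
    refine le_trans ?_ (h t (by omega))
    refine le_trans ?_ (Complex.re_le_norm _)
    rw [Complex.re_sum]
    refine (hre x).trans (Finset.single_le_sum (f := fun y => (z y ^ t).re) ?_ (Finset.mem_univ x))
    intro y _
    exact le_trans (by positivity) (hre y)
  have h5 := hN t (by omega)
  rw [div_pow, lt_div_iff₀ (by positivity)] at h5
  linarith

lemma exists_omega (m : ℕ) (c : ℕ → ℂ) (h0 : c 0 = 1) (hc : ∀ n, m < n → c n = 0) :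
    ∃ ω : Fin m → ℂ, ∀ j, (Finset.univ.val.map ω).esymm j = (-1)^j * c j := by
  set p : ℂ[X] := mon m (fun i => c (m - i)) with hp
  have hm : p.Monic := mon_monic _ _
  have hd : p.natDegree = m := mon_natDegree _ _
  have hcard : p.roots.card = p.natDegree := (splits_iff_card_roots).1 (IsAlgClosed.splits p)
  obtain ⟨l, hl⟩ : ∃ l : List ℂ, (l : Multiset ℂ) = p.roots := ⟨p.roots.toList, by simp⟩
  have hlen : l.length = m := by rw [← hd, ← hcard, ← hl]; simp
  subst hlen
  refine ⟨l.get, ?_⟩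
  have hr : (Finset.univ.val.map l.get : Multiset ℂ) = p.roots := by
    rw [← hl]; simp
  rw [hr]
  intro j
  by_cases hj : j ≤ l.length
  · have h := coeff_eq_esymm_roots_of_card hcard (k := l.length - j) (by omega)
    rw [hd, hm.leadingCoeff, one_mul, show l.length - (l.length - j) = j by omega] at h
    have h2 : p.coeff (l.length - j) = c j := by
      rcases Nat.eq_zero_or_pos j with rfl | hj0
      · rw [h0]; have := hm.coeff_natDegree; rw [hd] at this; simpa using this
      · have := mon_coeff (n := l.length) (fun i => c (l.length - i)) ⟨l.length - j, by omega⟩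
        rw [hp]; simp only at this ; rw [this]; congr 1; omega
    rw [← h2, h, ← mul_assoc, ← mul_pow]; simp
  · rw [hc j (by omega), mul_zero]
    unfold Multiset.esymm
    rw [Multiset.powersetCard_eq_empty _ (by rw [hcard, hd]; omega)]; simp

section
variable {F : Type*} [Field F] [Fintype F]
lemma Sn_eq {m : ℕ} {χ : AddChar (Additive (GG F m)) ℂ} (hχ : χ ≠ 0) :
    ∃ ω : Fin m → ℂ, ∀ n, 1 ≤ n → Sn χ n = - ∑ x, ω x ^ n := by
  obtain ⟨ω, hω⟩ := exists_omega m (cn χ) (cn_zero χ) (fun n hn => cn_eq_zero hχ hn.le)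
  refine ⟨ω, fun n => ?_⟩
  induction n using Nat.strong_induction_on with
  | _ n ih =>
  intro hn
  have h1 := newton_aeval ω n
  have h2 := L_newton χ n
  rw [hω] at h1
  simp only [hω] at h1
  have h1' : (n:ℂ) * cn χ n = - ∑ i ∈ Finset.range n, cn χ i * ∑ x, ω x ^ (n-i) := by
    have e : ((-1:ℂ))^n * (-1)^n = 1 := by rw [← mul_pow]; simp
    have e2 : ∑ i ∈ Finset.range n, (-1:ℂ)^i * ((-1)^i * cn χ i) * ∑ x, ω x ^ (n-i)
       = ∑ i ∈ Finset.range n, cn χ i * ∑ x, ω x ^ (n-i) := by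
      refine Finset.sum_congr rfl fun i _ => ?_
      rw [← mul_assoc ((-1:ℂ)^i), ← mul_pow]; simp
    rw [e2, pow_succ] at h1
    linear_combination (-1:ℂ)^n * h1 - ((n:ℂ) * cn χ n + ∑ i ∈ Finset.range n, cn χ i * ∑ x, ω x ^ (n-i)) * e
  have h3 : ∑ i ∈ Finset.Icc 1 n, Sn χ i * cn χ (n - i) = ∑ i ∈ Finset.range n, cn χ i * Sn χ (n-i) := by
    refine Finset.sum_bij' (fun i _ => n - i) (fun i _ => n - i) ?_ ?_ ?_ ?_ ?_
    · intro a ha; rw [Finset.mem_Icc] at ha; rw [Finset.mem_range]; omega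
    · intro a ha; rw [Finset.mem_range] at ha; rw [Finset.mem_Icc]; omega
    · intro a ha; rw [Finset.mem_Icc] at ha; omega
    · intro a ha; rw [Finset.mem_range] at ha; omega
    · intro a ha; rw [Finset.mem_Icc] at ha; rw [show n - (n - a) = a by omega, mul_comm]
  rw [h1', h3] at h2
  obtain ⟨n, rfl⟩ : ∃ n', n = n' + 1 := ⟨n - 1, by omega⟩
  rw [Finset.sum_range_succ', Finset.sum_range_succ' (fun i => cn χ i * Sn χ (n+1-i)), cn_zero] at h2
  have h4 : ∑ k ∈ Finset.range n, cn χ (k + 1) * Sn χ (n + 1 - (k + 1)) =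
     - ∑ k ∈ Finset.range n, cn χ (k + 1) * ∑ x, ω x ^ (n + 1 - (k + 1)) := by
    rw [← Finset.sum_neg_distrib]
    refine Finset.sum_congr rfl fun i hi => ?_
    rw [Finset.mem_range] at hi
    rw [ih (n+1-(i+1)) (by omega) (by omega)]; ring
  rw [h4] at h2
  simp only [Nat.sub_zero, one_mul] at h2
  linear_combination -h2

lemma weil_of_bound {m : ℕ} {χ : AddChar (Additive (GG F m)) ℂ} (hχ : χ ≠ 0) (C : ℝ) (T : ℕ)
    (h : ∀ t, T ≤ t → ‖Sn χ (2*t)‖ ≤ C * (Fintype.card F : ℝ)^t) :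
    ‖∑ a : F, chi χ (X - Polynomial.C a)‖ ≤ m * Real.sqrt (Fintype.card F) := by
  obtain ⟨ω, hω⟩ := Sn_eq hχ
  have hq : (0:ℝ) < Fintype.card F := by exact_mod_cast Fintype.card_pos
  have hb := compact_bound (fun x => ω x ^ 2) (Fintype.card F) C hq (T+1) (by
    intro t ht
    have := h t (by omega)
    rw [hω _ (by omega), norm_neg] at this
    simpa only [← pow_mul] using this)
  rw [← Sn_one, hω 1 le_rfl, norm_neg]
  refine (norm_sum_le _ _).trans ?_
  have : ∀ x ∈ Finset.univ, ‖ω x ^ 1‖ ≤ Real.sqrt (Fintype.card F) := by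
    intro x _
    rw [pow_one]; apply Real.le_sqrt_of_sq_le
    have := hb x
    rwa [norm_pow] at this
  refine (Finset.sum_le_sum this).trans ?_
  simp

open Classical in
lemma bound_of_count {m : ℕ} {χ : AddChar (Additive (GG F m)) ℂ} (hχ : χ ≠ 0) (C : ℕ) (t : ℕ) (ht : t ≠ 0)
    (h : ∀ g : GG F m, Fintype.card F ^ m * ((Fi F (2*t)).filter (fun a => cls m (QF (2*t) a) = g)).card ≤
      Fintype.card F ^ (2*t) + C * Fintype.card F ^ t) :
    ‖Sn χ (2*t)‖ ≤ C * (Fintype.card F : ℝ)^t := by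
  set N : GG F m → ℕ := fun g => ((Fi F (2*t)).filter (fun a => cls m (QF (2*t) a) = g)).card with hN
  have hq : (0:ℝ) < Fintype.card F := by exact_mod_cast Fintype.card_pos
  have hs : Sn χ (2*t) = ∑ g : GG F m, (N g : ℂ) * χ (Additive.ofMul g) := by
    unfold Sn chi
    rw [← Finset.sum_fiberwise (Fi F (2*t)) (fun a => cls m (QF (2*t) a))]
    refine Finset.sum_congr rfl fun g _ => ?_
    rw [Finset.sum_congr rfl (g := fun _ => χ (Additive.ofMul g))]
    · simp [hN]
    · intro a ha; rw [(Finset.mem_filter.1 ha).2]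
  have hN1 : ∑ g : GG F m, N g = Fintype.card F ^ (2*t) := by
    rw [← card_Fi (F := F) (i := 2*t) (by omega)]
    exact (Finset.card_eq_sum_card_fiberwise (fun a _ => Finset.mem_univ _)).symm
  set U : ℝ := ((Fintype.card F:ℝ)^(2*t) + C * (Fintype.card F:ℝ)^t) / (Fintype.card F:ℝ)^m with hU
  have hU1 : ∀ g, (N g : ℝ) ≤ U := by
    intro g
    rw [hU, le_div_iff₀ (by positivity), mul_comm]
    exact_mod_cast h g
  have h0 : ∑ g : GG F m, χ (Additive.ofMul g) = 0 := by
    have h := AddChar.sum_eq_zero_iff_ne_zero.2 hχ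
    rw [← h]
    exact Fintype.sum_equiv Additive.ofMul _ _ (fun _ => rfl)
  have hs2 : Sn χ (2*t) = - ∑ g : GG F m, ((U - N g : ℝ) : ℂ) * χ (Additive.ofMul g) := by
    rw [hs]; push_cast
    simp only [sub_mul, Finset.sum_sub_distrib, ← Finset.mul_sum, h0]; ring
  rw [hs2, norm_neg]
  refine (norm_sum_le _ _).trans ?_
  have : ∀ g ∈ Finset.univ, ‖((U - N g : ℝ) : ℂ) * χ (Additive.ofMul g)‖ ≤ U - N g := by
    intro g _
    rw [norm_mul, AddChar.norm_apply, mul_one, Complex.norm_real, Real.norm_of_nonneg (by linarith [hU1 g])]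
  refine (Finset.sum_le_sum this).trans ?_
  rw [Finset.sum_sub_distrib, Finset.sum_const, Finset.card_univ, card_GG, nsmul_eq_mul, ← Nat.cast_sum, hN1, hU]
  push_cast
  rw [mul_div_cancel₀ _ (by positivity)]
  linarith
end

section Step
variable {F : Type*} [Field F] {A : Type*} [CommRing A] [Algebra F A]

/-- span of `B h`, `h ∈ H`, `h < n` -/
def Ls (F : Type*) [Field F] {A : Type*} [CommRing A] [Algebra F A] (H : Set ℕ) (B : ℕ → A) (n : ℕ) :
    Submodule F A := Submodule.span F (B '' {h | h ∈ H ∧ h < n})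

variable {H : Set ℕ} {B : ℕ → A}

lemma Ls_mono {n n' : ℕ} (h : n ≤ n') : Ls F H B n ≤ Ls F H B n' :=
  Submodule.span_mono (Set.image_mono fun _ hx => ⟨hx.1, hx.2.trans_le h⟩)

lemma mem_Ls {h n : ℕ} (hh : h ∈ H) (hn : h < n) : B h ∈ Ls F H B n :=
  Submodule.subset_span ⟨h, ⟨hh, hn⟩, rfl⟩

lemma Ls_zero : Ls F H B 0 = ⊥ := by
  unfold Ls; simp

lemma Ls_succ {n : ℕ} {y : A} (hy : y ∈ Ls F H B (n+1)) :
    y ∈ Ls F H B n ∨ (n ∈ H ∧ ∃ c : F, c ≠ 0 ∧ ∃ z ∈ Ls F H B n, y = c • B n + z) := by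
  by_cases hn : n ∈ H
  · have e : {h | h ∈ H ∧ h < n+1} = insert n {h | h ∈ H ∧ h < n} := by
      ext h; simp only [Set.mem_ofPred_eq, Set.mem_insert_iff]
      constructor
      · rintro ⟨h1, h2⟩
        rcases Nat.lt_succ_iff_lt_or_eq.1 h2 with h3 | h3
        · exact Or.inr ⟨h1, h3⟩
        · exact Or.inl h3
      · rintro (rfl | ⟨h1, h2⟩)
        · exact ⟨hn, by omega⟩
        · exact ⟨h1, by omega⟩
    unfold Ls at hy
    rw [e, Set.image_insert_eq, Submodule.mem_span_insert] at hy
    obtain ⟨c, z, hz, rfl⟩ := hy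
    by_cases hc : c = 0
    · left; rw [hc, zero_smul, zero_add]; exact hz
    · right; exact ⟨hn, c, hc, z, hz, rfl⟩
  · left
    have e : {h | h ∈ H ∧ h < n+1} = {h | h ∈ H ∧ h < n} := by
      ext h; simp only [Set.mem_ofPred_eq]
      constructor
      · rintro ⟨h1, h2⟩
        refine ⟨h1, ?_⟩
        rcases Nat.lt_succ_iff_lt_or_eq.1 h2 with h3 | h3
        · exact h3
        · subst h3; exact absurd h1 hn
      · rintro ⟨h1, h2⟩; exact ⟨h1, by omega⟩
    unfold Ls at hy
    rwa [e] at hy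

lemma Ls_lead {n : ℕ} {y : A} (hy : y ∈ Ls F H B n) :
    y = 0 ∨ ∃ h, h < n ∧ h ∈ H ∧ ∃ c : F, c ≠ 0 ∧ ∃ z ∈ Ls F H B h, y = c • B h + z := by
  induction n with
  | zero => left; rw [Ls_zero] at hy; simpa using hy
  | succ n ih =>
    rcases Ls_succ hy with h | ⟨h1, c, hc, z, hz, e⟩
    · rcases ih h with h | ⟨h, h1, h2⟩
      · exact Or.inl h
      · exact Or.inr ⟨h, by omega, h2⟩
    · exact Or.inr ⟨n, by omega, h1, c, hc, z, hz, e⟩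

instance Ls_fin (n : ℕ) : Module.Finite F (Ls F H B n) := by
  unfold Ls
  apply Module.Finite.span_of_finite
  exact ((Set.finite_lt_nat n).subset fun x hx => hx.2).image _

lemma Ls_finrank (n : ℕ) : Module.finrank F (Ls F H B n) ≤ n := by
  classical
  have hf : {h | h ∈ H ∧ h < n}.Finite := (Set.finite_lt_nat n).subset fun x hx => hx.2
  have e : Ls F H B n = Submodule.span F ((hf.toFinset.image B : Finset A) : Set A) := by
    unfold Ls; simp
  rw [e]
  refine (finrank_span_finset_le_card _).trans (Finset.card_image_le.trans ?_)
  have : hf.toFinset ⊆ Finset.range n := by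
    intro x hx; simp at hx; simpa using hx.2
  simpa using Finset.card_le_card this

variable {Γ : Type*} [LinearOrderedCommGroupWithZero Γ] (v : Valuation A Γ) {β : Γ}

lemma Ls_val (hvF : ∀ c : F, c ≠ 0 → v (algebraMap F A c) = 1) (hβ : 1 < β)
    (hB : ∀ h ∈ H, v (B h) = β ^ h) {n : ℕ} {y : A} (hy : y ∈ Ls F H B n) : v y < β ^ n := by
  have h0 : (0:Γ) < β ^ n := pow_pos (zero_lt_one.trans hβ) n
  unfold Ls at hy
  induction hy using Submodule.span_induction with
  | mem x hx =>
    obtain ⟨h, ⟨h1, h2⟩, rfl⟩ := hx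
    rw [hB h h1]; exact pow_lt_pow_right₀ hβ h2
  | zero => rw [map_zero]; exact h0
  | add x y _ _ hx hy => exact v.map_add_lt hx hy
  | smul c x _ hx =>
    by_cases hc : c = 0
    · simpa [hc] using h0
    · rw [Algebra.smul_def, map_mul, hvF c hc, one_mul]; exact hx

lemma lead_val (hvF : ∀ c : F, c ≠ 0 → v (algebraMap F A c) = 1) (hβ : 1 < β)
    (hB : ∀ h ∈ H, v (B h) = β ^ h) {h : ℕ} (hh : h ∈ H) {c : F} (hc : c ≠ 0) {z : A} (hz : z ∈ Ls F H B h) :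
    v (c • B h + z) = β ^ h := by
  have h1 : v (c • B h) = β ^ h := by rw [Algebra.smul_def, map_mul, hvF c hc, one_mul, hB h hh]
  rw [Valuation.map_add_eq_of_lt_left, h1]
  rw [h1]; exact Ls_val v hvF hβ hB hz

theorem stepanov [Fintype F] {K : Type*} [Field K] [Algebra F K]
    (hvF : ∀ c : F, c ≠ 0 → v (algebraMap F A c) = 1) (hβ : 1 < β)
    (hB : ∀ h ∈ H, v (B h) = β ^ h) (W : ℕ) (hW : ∀ h, W ≤ h → h ∈ H)
    (hone : (1:A) ∈ Ls F H B 1)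
    (hmul : ∀ n n' x y, x ∈ Ls F H B (n+1) → y ∈ Ls F H B (n'+1) → x * y ∈ Ls F H B (n+n'+1))
    (hspan : ∀ x, ∃ n, x ∈ Ls F H B n)
    (γ : A →ₐ[F] A) (hγ : ∀ n x, x ∈ Ls F H B n → γ x ∈ Ls F H B n)
    (t s : ℕ) (hs : s = Fintype.card F ^ t) (hsW : W^2+3*W+1 < s)
    (S : Finset (A →ₐ[F] K)) (hS : ∀ x ∈ S, ∀ b, x (γ b) = x b ^ (s^2)) :
    S.card ≤ s^2 + (3*W+1)*s := by
  classical
  have hpow : ∀ h ∈ H, ∀ j, B h ^ j ∈ Ls F H B (h*j+1) := by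
    intro h hh j
    induction j with
    | zero => simpa using hone
    | succ j ih =>
      rw [pow_succ, Nat.mul_succ]
      exact hmul _ _ _ _ ih (mem_Ls hh (by omega))
  -- index set
  set I := Finset.Ico W s ×ˢ Finset.Ico W (s+2*W+1) with hI
  have hIH : ∀ p ∈ I, p.1 ∈ H ∧ p.2 ∈ H ∧ p.1 < s ∧ p.2 ≤ s+2*W := by
    intro p hp
    rw [hI, Finset.mem_product, Finset.mem_Ico, Finset.mem_Ico] at hp
    exact ⟨hW _ hp.1.1, hW _ hp.2.1, hp.1.2, by omega⟩
  have hIc : I.card = (s - W) * (s + W + 1) := by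
    rw [hI, Finset.card_product, Nat.card_Ico, Nat.card_Ico]; congr 1; omega
  set N := s^2 + 2*W+1 with hN
  have hmem : ∀ p ∈ I, B p.1 ^ s * γ (B p.2) ∈ Ls F H B N := by
    intro p hp
    obtain ⟨h1, h2, h3, h4⟩ := hIH p hp
    refine Ls_mono ?_ (hmul _ _ _ _ (hpow p.1 h1 s) (hγ _ _ (mem_Ls (n := p.2+1) h2 (by omega))))
    have : (p.1+1) * s ≤ s * s := Nat.mul_le_mul_right _ h3
    rw [hN]; nlinarith
  have hcard : N < I.card := by
    rw [hIc, hN]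
    have hWs : W ≤ s := by nlinarith
    clear_value N
    clear hIc hmem hIH hI I hN
    obtain ⟨r, rfl⟩ : ∃ r, s = W + r := ⟨s - W, by omega⟩
    rw [Nat.add_sub_cancel_left]; nlinarith
  obtain ⟨c, hcsum, p0, hp0⟩ : ∃ c : I → F, ∑ p, c p • (B p.1.1 ^ s * γ (B p.1.2)) = 0 ∧ ∃ p, c p ≠ 0 := by
    by_contra hcon
    have hli : LinearIndependent F (fun p : I => (⟨B p.1.1 ^ s * γ (B p.1.2), hmem p.1 p.2⟩ : Ls F H B N)) := by
      rw [Fintype.linearIndependent_iff]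
      intro c hc p
      by_contra hp
      apply hcon
      refine ⟨c, ?_, p, hp⟩
      have := congrArg (Submodule.subtype _) hc
      simpa using this
    have h1 := hli.fintype_card_le_finrank
    have h2 := Ls_finrank (F := F) (H := H) (B := B) N
    rw [Fintype.card_coe] at h1
    omega
  set Ψ : A := ∑ p, c p • (B p.1.1 * B p.1.2 ^ s) with hΨ
  have hFs : ∀ x : F, x ^ s = x := by intro x; rw [hs]; exact FiniteField.pow_card_pow t x
  have hkill : ∀ x ∈ S, x Ψ = 0 := by
    intro x hx
    have hs0 : s ≠ 0 := by omega
    rw [← pow_eq_zero_iff hs0]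
    obtain ⟨p, hp⟩ := CharP.exists F
    have := hp
    obtain ⟨r, hpp, hr⟩ := FiniteField.card F p
    have : CharP K p := charP_of_injective_algebraMap (algebraMap F K).injective p
    have : Fact p.Prime := ⟨hpp⟩
    have : ExpChar K p := ExpChar.prime hpp
    have hsp : s = p ^ (r * t) := by rw [hs, hr, pow_mul]
    rw [hΨ, map_sum, hsp, sum_pow_char_pow, ← hsp]
    have h3 := congrArg x hcsum
    rw [map_zero, map_sum] at h3
    rw [← h3]
    refine Finset.sum_congr rfl fun i _ => ?_
    rw [map_smul, map_smul, map_mul, map_mul, map_pow, map_pow, hS x hx, Algebra.smul_def, Algebra.smul_def,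
      mul_pow, mul_pow, ← map_pow, hFs, ← pow_mul, sq]
  have hval : ∀ p : I, c p ≠ 0 → v (c p • (B p.1.1 * B p.1.2 ^ s)) = β ^ (p.1.1 + p.1.2 * s) := by
    intro p hp
    obtain ⟨h1, h2, h3, h4⟩ := hIH p.1 p.2
    rw [Algebra.smul_def, map_mul, hvF _ hp, one_mul, map_mul, map_pow, hB _ h1, hB _ h2, pow_add, pow_mul]
  have hΨ0 : Ψ ≠ 0 := by
    obtain ⟨pm, hpm, hmax⟩ := Finset.exists_max_image (Finset.univ.filter fun p : I => c p ≠ 0)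
      (fun p => p.1.1 + p.1.2 * s) ⟨p0, by simpa using hp0⟩
    rw [Finset.mem_filter] at hpm
    have : v Ψ = β ^ (pm.1.1 + pm.1.2 * s) := by
      rw [← hval pm hpm.2, hΨ]
      apply Valuation.map_sum_eq_of_lt _ (Finset.mem_univ pm)
      intro p hp
      rw [hval pm hpm.2]
      by_cases hc : c p = 0
      · rw [hc, zero_smul, map_zero]; exact pow_pos (zero_lt_one.trans hβ) _
      · rw [hval p hc]
        apply pow_lt_pow_right₀ hβ
        have h1 := hmax p (by simpa using hc)
        refine lt_of_le_of_ne h1 fun he => ?_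
        have hne : p ≠ pm := by simpa using hp
        apply hne
        have a1 := (hIH p.1 p.2).2.2.1
        have a2 := (hIH pm.1 pm.2).2.2.1
        have hm := congrArg (· % s) he
        have hd := congrArg (· / s) he
        have hs0 : 0 < s := by omega
        simp only [Nat.add_mul_mod_self_right, Nat.mod_eq_of_lt a1, Nat.mod_eq_of_lt a2] at hm
        simp only [Nat.add_mul_div_right _ _ hs0, Nat.div_eq_of_lt a1, Nat.div_eq_of_lt a2, zero_add] at hd
        exact Subtype.ext (Prod.ext hm hd)
    intro h0
    rw [h0, map_zero] at this
    exact (pow_pos (zero_lt_one.trans hβ) _).ne this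
  have hΨL : Ψ ∈ Ls F H B ((s - 1) + (s+2*W)*s + 1) := by
    rw [hΨ]
    refine Submodule.sum_mem _ fun p _ => Submodule.smul_mem _ _ ?_
    obtain ⟨h1, h2, h3, h4⟩ := hIH p.1 p.2
    refine Ls_mono ?_ (hmul _ _ _ _ (mem_Ls (n := p.1.1+1) h1 (by omega)) (hpow _ h2 s))
    have : p.1.2 * s ≤ (s+2*W)*s := Nat.mul_le_mul_right _ h4
    omega
  obtain ⟨w, hw1, hw2, cw, hcw, zw, hzw, hΨe⟩ := (Ls_lead hΨL).resolve_left hΨ0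
  have hΨw : Ψ ∈ Ls F H B (w+1) := by
    rw [hΨe]
    exact Submodule.add_mem _ (Submodule.smul_mem _ _ (mem_Ls hw2 (by omega))) (Ls_mono (by omega) hzw)
  have hΨv : v Ψ = β ^ w := by rw [hΨe]; exact lead_val v hvF hβ hB hw2 hcw hzw
  set J : Ideal A := Ideal.span {Ψ} with hJ
  set T : Submodule F A := Ls F H B (w+W) ⊔ J.restrictScalars F with hT
  have hLT : ∀ n, Ls F H B n ≤ T := by
    intro n
    induction n with
    | zero => rw [Ls_zero]; exact bot_le
    | succ n ih =>
      by_cases hn : n < w + W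
      · exact (Ls_mono (by omega)).trans le_sup_left
      · push Not at hn
        intro y hy
        rcases Ls_succ hy with h | ⟨h1, c, hc, z, hz, e⟩
        · exact ih h
        · rw [e]
          refine T.add_mem (T.smul_mem _ ?_) (ih hz)
          have hb : n - w ∈ H := hW _ (by omega)
          have y1 : B (n-w) * Ψ ∈ Ls F H B (n+1) := by
            have := hmul _ _ _ _ (mem_Ls (n := (n-w)+1) hb (by omega)) hΨw
            rwa [show n - w + w = n by omega] at this
          have y2 : v (B (n-w) * Ψ) = β ^ n := by
            rw [map_mul, hB _ hb, hΨv, ← pow_add]; congr 1; omega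
          have y3 : B (n-w) * Ψ ∈ T := by
            apply (le_sup_right : J.restrictScalars F ≤ T)
            exact J.mul_mem_left _ (Ideal.subset_span rfl)
          rcases Ls_succ y1 with h | ⟨h1', c', hc', z', hz', e'⟩
          · exact absurd y2 (Ls_val v hvF hβ hB h).ne
          · have : B n = c'⁻¹ • (B (n-w) * Ψ - z') := by
              rw [e', add_sub_cancel_right, smul_smul, inv_mul_cancel₀ hc', one_smul]
            rw [this]
            exact T.smul_mem _ (T.sub_mem y3 (ih hz'))
  have hTtop : T = ⊤ := by
    rw [eq_top_iff]; intro x _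
    obtain ⟨n, hn⟩ := hspan x
    exact hLT n hn
  set f : Ls F H B (w+W) →ₗ[F] (A ⧸ J) := (Ideal.Quotient.mkₐ F J).toLinearMap ∘ₗ (Ls F H B (w+W)).subtype with hf
  have hfs : Function.Surjective f := by
    intro y
    obtain ⟨x, rfl⟩ := Ideal.Quotient.mk_surjective y
    have hx : x ∈ T := by rw [hTtop]; trivial
    rw [hT, Submodule.mem_sup] at hx
    obtain ⟨y, hy, z, hz, rfl⟩ := hx
    refine ⟨⟨y, hy⟩, ?_⟩
    have hz' : z ∈ J := hz
    simp only [hf, LinearMap.comp_apply, Submodule.subtype_apply, AlgHom.toLinearMap_apply, Ideal.Quotient.mkₐ_eq_mk, map_add,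
      Ideal.Quotient.eq_zero_iff_mem.2 hz', add_zero]
  have : Module.Finite F (A ⧸ J) := Module.Finite.of_surjective f hfs
  have hfr : Module.finrank F (A ⧸ J) ≤ w + W :=
    (LinearMap.finrank_le_finrank_of_surjective hfs).trans (Ls_finrank _)
  have hJk : ∀ x ∈ S, ∀ a ∈ J, x a = 0 := by
    intro x hx a ha
    rw [hJ, Ideal.mem_span_singleton'] at ha
    obtain ⟨b, rfl⟩ := ha
    rw [map_mul, hkill x hx, mul_zero]
  have hcS : S.card ≤ Nat.card ((A ⧸ J) →ₐ[F] K) := by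
    have hfin : Finite ((A ⧸ J) →ₐ[F] K) := inferInstance
    rw [← Fintype.card_coe, ← Nat.card_eq_fintype_card]
    refine Nat.card_le_card_of_injective (fun x : S => Ideal.Quotient.liftₐ J x.1 (hJk x.1 x.2)) ?_
    intro x y hxy
    apply Subtype.ext
    ext a
    have := congrArg (fun φ : (A ⧸ J) →ₐ[F] K => φ (Ideal.Quotient.mk J a)) hxy
    exact this
  have hfinal := hcS.trans ((card_algHom_le_finrank F (A ⧸ J) K).trans hfr)
  have : (1:ℕ) ≤ s := by omega
  have : W ≤ W * s := Nat.le_mul_of_pos_right _ this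
  have e1 : s - 1 + 1 = s := by omega
  have e2 : w < s + (s+2*W)*s := by omega
  nlinarith
end Step

section Wt

/-- weights of the generators -/
def ww (q m j : ℕ) : ℕ := ∑ i ∈ Finset.range j, q ^ (m - 1 - i)

lemma ww_succ_mul (q m j : ℕ) (hj : j < m) : q * ww q m (j+1) = q ^ m + ww q m j := by
  unfold ww
  rw [Finset.mul_sum, Finset.sum_range_succ']
  have h1 : q * q ^ (m - 1 - 0) = q ^ m := by
    rw [← pow_succ']; congr 1; omega
  rw [h1, add_comm]
  congr 1
  refine Finset.sum_congr rfl fun i hi => ?_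
  rw [Finset.mem_range] at hi
  rw [← pow_succ']; congr 1; omega

lemma ww_mono (q m : ℕ) : Monotone (ww q m) := by
  intro a b h
  exact Finset.sum_le_sum_of_subset (Finset.range_mono h)

lemma ww_digit (q m j : ℕ) (hq : 1 ≤ q) (hj : j < m) : (q - 1) * ww q m (j+1) + q ^ (m - 1 - j) = q ^ m := by
  obtain ⟨r, rfl⟩ : ∃ r, q = r + 1 := ⟨q - 1, by omega⟩
  have h := ww_succ_mul (r+1) m j hj
  have h2 : ww (r+1) m (j+1) = ww (r+1) m j + (r+1) ^ (m-1-j) := by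
    unfold ww; rw [Finset.sum_range_succ]
  simp only [Nat.add_sub_cancel]
  nlinarith

/-- weight of a monomial -/
def wt (q m i : ℕ) (e : Fin m → ℕ) : ℕ := i * q ^ m + ∑ j : Fin m, e j * ww q m (j+1)

lemma red_inj {q m : ℕ} (hq : 2 ≤ q) {e e' : Fin m → ℕ} (he : ∀ j, e j < q) (he' : ∀ j, e' j < q)
    (h : (∑ j : Fin m, e j * ww q m (j+1)) ≡ (∑ j : Fin m, e' j * ww q m (j+1)) [MOD q ^ m]) : e = e' := by
  have key : ∀ f : Fin m → ℕ, (∑ j : Fin m, f j * q ^ (m-1-(j:ℕ))) + (q-1) * (∑ j : Fin m, f j * ww q m (j+1))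
      = (∑ j, f j) * q ^ m := by
    intro f
    rw [Finset.mul_sum, ← Finset.sum_add_distrib, Finset.sum_mul]
    refine Finset.sum_congr rfl fun j _ => ?_
    rw [← ww_digit q m j (by omega) j.2]; ring
  have dig : ∀ f : Fin m → ℕ, ∀ hf : ∀ j, f j < q, (∑ j : Fin m, f j * q ^ (m-1-(j:ℕ))) =
      (finFunctionFinEquiv (fun j : Fin m => (⟨f j.rev, hf _⟩ : Fin q))).val := by
    intro f hf
    rw [finFunctionFinEquiv_apply]
    refine Fintype.sum_equiv Fin.revPerm _ _ fun j => ?_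
    simp only [Fin.revPerm_apply, Fin.rev_rev, Fin.val_rev]
    congr 2; omega
  have h1 : (∑ j : Fin m, e j * q ^ (m-1-(j:ℕ))) ≡ (∑ j : Fin m, e' j * q ^ (m-1-(j:ℕ))) [MOD q^m] := by
    apply Nat.ModEq.add_right_cancel (h.mul_left (q-1))
    rw [key e, key e']
    exact ((Nat.modEq_zero_iff_dvd.2 (dvd_mul_left _ _)).trans (Nat.modEq_zero_iff_dvd.2 (dvd_mul_left _ _)).symm)
  rw [dig e he, dig e' he'] at h1
  have h2 := Nat.ModEq.eq_of_lt_of_lt h1 (Fin.is_lt _) (Fin.is_lt _)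
  have h3 := finFunctionFinEquiv.injective (Fin.ext h2)
  funext j
  have := congrFun h3 j.rev
  simpa using this

lemma wt_inj {q m : ℕ} (hq : 2 ≤ q) {i i' : ℕ} {e e' : Fin m → ℕ} (he : ∀ j, e j < q) (he' : ∀ j, e' j < q)
    (h : wt q m i e = wt q m i' e') : i = i' ∧ e = e' := by
  have h1 : e = e' := by
    apply red_inj hq he he'
    unfold wt at h
    have h2 : ∀ (i : ℕ) (s : ℕ), i * q^m + s ≡ s [MOD q^m] := by
      intro i s; simp [Nat.ModEq]
    exact (h2 i _).symm.trans ((by rw [h] : Nat.ModEq (q^m) (i * q ^ m + ∑ j : Fin m, e j * ww q m (j+1)) _).trans (h2 i' _)) 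
  subst h1
  refine ⟨?_, rfl⟩
  unfold wt at h
  have : 0 < q ^ m := by positivity
  exact Nat.eq_of_mul_eq_mul_right this (by omega)

lemma wt_surj {q m : ℕ} (hq : 2 ≤ q) {h : ℕ} (hh : (∑ j : Fin m, q * ww q m (j+1)) ≤ h) :
    ∃ i, ∃ e : Fin m → ℕ, (∀ j, e j < q) ∧ wt q m i e = h := by
  have hpos : 0 < q ^ m := by positivity
  set φ : (Fin m → Fin q) → Fin (q ^ m) := fun e => ⟨(∑ j : Fin m, (e j : ℕ) * ww q m (j+1)) % q^m, Nat.mod_lt _ hpos⟩ with hφ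
  have hi : Function.Injective φ := by
    intro e e' hee
    have h1 := congrArg Fin.val hee
    have := red_inj hq (fun j => (e j).2) (fun j => (e' j).2) h1
    funext j
    exact Fin.ext (congrFun this j)
  have hs : Function.Surjective φ := by
    have := (Fintype.bijective_iff_injective_and_card φ).2 ⟨hi, by simp⟩
    exact this.2
  obtain ⟨e, he⟩ := hs ⟨h % q^m, Nat.mod_lt _ hpos⟩
  have h1 : (∑ j : Fin m, (e j : ℕ) * ww q m (j+1)) ≡ h [MOD q^m] := congrArg Fin.val he
  have h2 : (∑ j : Fin m, (e j : ℕ) * ww q m (j+1)) ≤ h :=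
    le_trans (Finset.sum_le_sum fun j _ => Nat.mul_le_mul_right _ (e j).2.le) hh
  obtain ⟨i, hi⟩ := (Nat.modEq_iff_dvd' h2).1 h1
  refine ⟨i, fun j => e j, fun j => (e j).2, ?_⟩
  unfold wt
  rw [mul_comm i, ← hi]
  exact Nat.sub_add_cancel h2

end Wt

section Mono
variable {A : Type*} [CommRing A] {m : ℕ}

/-- monomials -/
def mono (m : ℕ) (a : A) (U : ℕ → A) (i : ℕ) (e : Fin m → ℕ) : A := a ^ i * ∏ j : Fin m, U (j+1) ^ e j

lemma mono_mul (a : A) (U : ℕ → A) (i i' : ℕ) (e e' : Fin m → ℕ) :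
    mono m a U i e * mono m a U i' e' = mono m a U (i+i') (e+e') := by
  unfold mono
  simp only [Pi.add_apply, pow_add, Finset.prod_mul_distrib]; ring

lemma wt_add (q i i' : ℕ) (e e' : Fin m → ℕ) : wt q m (i+i') (e+e') = wt q m i e + wt q m i' e' := by
  unfold wt
  simp only [Pi.add_apply, add_mul, Finset.sum_add_distrib]; ring

lemma mono_single (a : A) (U : ℕ → A) (j : Fin m) (k : ℕ) : mono m a U 0 (Pi.single j k) = U (j+1) ^ k := by
  unfold mono
  rw [pow_zero, one_mul, Finset.prod_eq_single j]
  · simp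
  · intro b _ hb; simp [Pi.single_eq_of_ne hb]
  · simp

lemma wt_single (q : ℕ) (j : Fin m) (k : ℕ) : wt q m 0 (Pi.single j k) = k * ww q m (j+1) := by
  unfold wt
  rw [zero_mul, zero_add, Finset.sum_eq_single j]
  · simp
  · intro b _ hb; simp [Pi.single_eq_of_ne hb]
  · simp

lemma mono_a (a : A) (U : ℕ → A) (i : ℕ) : mono m a U i 0 = a ^ i := by simp [mono]
lemma wt_a (q i : ℕ) : wt q m i 0 = i * q ^ m := by simp [wt]

variable (F : Type*) [Field F] [Algebra F A]

/-- span of reduced monomials of weight `< n` -/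
def Rs (q m : ℕ) (a : A) (U : ℕ → A) (n : ℕ) : Submodule F A :=
  Submodule.span F {x | ∃ i, ∃ e : Fin m → ℕ, (∀ j, e j < q) ∧ wt q m i e < n ∧ x = mono m a U i e}

lemma Rs_mono {q : ℕ} (a : A) (U : ℕ → A) {n n' : ℕ} (h : n ≤ n') : Rs F q m a U n ≤ Rs F q m a U n' :=
  Submodule.span_mono fun _ ⟨i, e, h1, h2, h3⟩ => ⟨i, e, h1, h2.trans_le h, h3⟩

lemma mono_mem_Rs {q : ℕ} (hq : 2 ≤ q) {a : A} {U : ℕ → A} (hU0 : U 0 = 1)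
    (hrel : ∀ j < m, U (j+1) ^ q = U (j+1) - a * U j) (i : ℕ) (e : Fin m → ℕ) (n : ℕ) (hn : wt q m i e < n) :
    mono m a U i e ∈ Rs F q m a U n := by
  induction hN : ∑ j, e j using Nat.strong_induction_on generalizing i e with
  | _ N ih =>
  by_cases hred : ∀ j, e j < q
  · exact Submodule.subset_span ⟨i, e, hred, hn, rfl⟩
  · push Not at hred
    obtain ⟨j, hj⟩ := hred
    obtain ⟨e0, rfl⟩ : ∃ e0 : Fin m → ℕ, e = e0 + Pi.single j q := by
      refine ⟨e - Pi.single j q, ?_⟩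
      funext k
      by_cases hk : k = j
      · subst hk; simp; omega
      · simp [Pi.single_eq_of_ne hk]
    have hsum : ∀ k : ℕ, ∑ l, (e0 + Pi.single j k : Fin m → ℕ) l = ∑ l, e0 l + k := by
      intro k
      simp [Finset.sum_add_distrib]
    have hw := ww_succ_mul q m j j.2
    have e1 : wt q m i (e0 + Pi.single j q) = wt q m i e0 + q * ww q m (j+1) := by
      have := wt_add q i 0 e0 (Pi.single j q)
      rw [wt_single] at this; exact this
    have e2 : wt q m i (e0 + Pi.single j 1) = wt q m i e0 + 1 * ww q m (j+1) := by
      have := wt_add q i 0 e0 (Pi.single j 1)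
      rw [wt_single] at this; exact this
    have m1 : mono m a U i (e0 + Pi.single j q) = mono m a U i (e0 + Pi.single j 1) - mono m a U (i+1) e0 * U j := by
      have t1 := mono_mul a U i 0 e0 (Pi.single j q)
      have t2 := mono_mul a U i 0 e0 (Pi.single j 1)
      have t3 := mono_mul a U i 1 e0 0
      rw [mono_single, add_zero] at t1 t2
      rw [mono_a, add_zero, pow_one] at t3
      rw [← t1, ← t2, ← t3, hrel j j.2]; ring
    rw [m1]
    rw [hsum] at hN
    have hww : ww q m (j+1) * 2 ≤ q * ww q m (j+1) := by rw [mul_comm]; exact Nat.mul_le_mul_right _ hq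
    refine Submodule.sub_mem _ ?_ ?_
    · exact ih _ (by omega) i (e0 + Pi.single j 1) (by omega) (hsum 1)
    · obtain ⟨j, hjm⟩ := j
      rcases j with _ | j
      · simp only [hU0, mul_one]
        refine ih _ (by omega) (i+1) e0 ?_ rfl
        have := wt_add q i 1 e0 0
        rw [wt_a, add_zero] at this
        simp only at e1 hw
        omega
      · have t := mono_mul a U (i+1) 0 e0 (Pi.single (⟨j, by omega⟩ : Fin m) 1)
        rw [mono_single, pow_one] at t
        simp only at t ⊢
        rw [t]
        have hsum' : ∑ l, (e0 + Pi.single (⟨j, by omega⟩ : Fin m) 1 : Fin m → ℕ) l = ∑ l, e0 l + 1 := by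
          simp [Finset.sum_add_distrib]
        refine ih _ (by omega) (i+1) _ ?_ hsum'
        have t1 := wt_add q (i+1) 0 e0 (Pi.single (⟨j, by omega⟩ : Fin m) 1)
        have t2 := wt_add q i 1 e0 0
        rw [wt_a, add_zero] at t2
        rw [wt_single] at t1
        simp only [add_zero] at t1 e1 hw ⊢
        omega

/-- weights of reduced monomials -/
def HH (q m : ℕ) : Set ℕ := {h | ∃ i, ∃ e : Fin m → ℕ, (∀ j, e j < q) ∧ wt q m i e = h}

open Classical in
/-- reduced monomial of given weight -/
noncomputable def BB (q m : ℕ) (a : A) (U : ℕ → A) (h : ℕ) : A :=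
  if hh : h ∈ HH q m then mono m a U hh.choose hh.choose_spec.choose else 0

lemma BB_wt {q : ℕ} (hq : 2 ≤ q) (a : A) (U : ℕ → A) (i : ℕ) (e : Fin m → ℕ) (he : ∀ j, e j < q) :
    BB q m a U (wt q m i e) = mono m a U i e := by
  have hh : wt q m i e ∈ HH q m := ⟨i, e, he, rfl⟩
  unfold BB
  rw [dif_pos hh]
  obtain ⟨h1, h2⟩ := wt_inj hq hh.choose_spec.choose_spec.1 he hh.choose_spec.choose_spec.2
  exact congrArg₂ (mono m a U) h1 h2

lemma Ls_eq_Rs {q : ℕ} (hq : 2 ≤ q) (a : A) (U : ℕ → A) (n : ℕ) :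
    Ls F (HH q m) (BB q m a U) n = Rs F q m a U n := by
  unfold Ls Rs
  congr 1
  ext x
  constructor
  · rintro ⟨h, ⟨⟨i, e, he, rfl⟩, hn⟩, rfl⟩
    exact ⟨i, e, he, hn, BB_wt hq a U i e he⟩
  · rintro ⟨i, e, he, hn, rfl⟩
    exact ⟨wt q m i e, ⟨⟨i, e, he, rfl⟩, hn⟩, BB_wt hq a U i e he⟩

lemma Rs_mul {q : ℕ} (hq : 2 ≤ q) {a : A} {U : ℕ → A} (hU0 : U 0 = 1)
    (hrel : ∀ j < m, U (j+1) ^ q = U (j+1) - a * U j) (n n' : ℕ) (x y : A)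
    (hx : x ∈ Rs F q m a U (n+1)) (hy : y ∈ Rs F q m a U (n'+1)) : x * y ∈ Rs F q m a U (n+n'+1) := by
  unfold Rs at hx hy
  induction hx, hy using Submodule.span_induction₂ with
  | mem_mem x y hx hy =>
    obtain ⟨i, e, he, hn, rfl⟩ := hx
    obtain ⟨i', e', he', hn', rfl⟩ := hy
    rw [mono_mul]
    apply mono_mem_Rs F hq hU0 hrel
    rw [wt_add]; omega
  | zero_left y hy => simp
  | zero_right x hx => simp
  | add_left x y z _ _ _ h1 h2 => rw [add_mul]; exact Submodule.add_mem _ h1 h2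
  | add_right x y z _ _ _ h1 h2 => rw [mul_add]; exact Submodule.add_mem _ h1 h2
  | smul_left r x y _ _ h => rw [smul_mul_assoc]; exact Submodule.smul_mem _ _ h
  | smul_right r x y _ _ h => rw [mul_smul_comm]; exact Submodule.smul_mem _ _ h

lemma Rs_one {q : ℕ} (hq : 2 ≤ q) {a : A} {U : ℕ → A} : (1:A) ∈ Rs F q m a U 1 :=
  Submodule.subset_span ⟨0, 0, fun j => by simp; omega, by simp [wt], by simp [mono]⟩

lemma Rs_span {q : ℕ} (hq : 2 ≤ q) {a : A} {U : ℕ → A} (hU0 : U 0 = 1)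
    (hrel : ∀ j < m, U (j+1) ^ q = U (j+1) - a * U j)
    (hgen : Algebra.adjoin F (insert a (Set.range fun j : Fin m => U (j+1))) = ⊤) (x : A) :
    ∃ n, x ∈ Rs F q m a U (n+1) := by
  have hx : x ∈ Algebra.adjoin F (insert a (Set.range fun j : Fin m => U (j+1))) := by rw [hgen]; trivial
  induction hx using Algebra.adjoin_induction with
  | mem x hx =>
    rcases hx with rfl | ⟨j, rfl⟩
    · refine ⟨wt q m 1 0, ?_⟩
      have := mono_mem_Rs F hq hU0 hrel 1 0 (wt q m 1 0 + 1) (by omega)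
      rwa [mono_a, pow_one] at this
    · refine ⟨wt q m 0 (Pi.single j 1), ?_⟩
      have := mono_mem_Rs F hq hU0 hrel 0 (Pi.single j 1) (wt q m 0 (Pi.single j 1) + 1) (by omega)
      rwa [mono_single, pow_one] at this
  | algebraMap r => exact ⟨0, by rw [Algebra.algebraMap_eq_smul_one]; exact Submodule.smul_mem _ _ (Rs_one F hq)⟩
  | add x y _ _ hx hy =>
    obtain ⟨n, hn⟩ := hx
    obtain ⟨n', hn'⟩ := hy
    exact ⟨n + n', Submodule.add_mem _ (Rs_mono F a U (by omega) hn) (Rs_mono F a U (by omega) hn')⟩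
  | mul x y _ _ hx hy =>
    obtain ⟨n, hn⟩ := hx
    obtain ⟨n', hn'⟩ := hy
    exact ⟨n + n', Rs_mul F hq hU0 hrel _ _ _ _ hn hn'⟩

lemma Rs_twist {q : ℕ} (hq : 2 ≤ q) {a : A} {U : ℕ → A} (hU0 : U 0 = 1)
    (hrel : ∀ j < m, U (j+1) ^ q = U (j+1) - a * U j) (γ : A →ₐ[F] A) (hγa : γ a = a)
    (g : ℕ → F) (hγU : ∀ n ≤ m, γ (U n) = ∑ p ∈ Finset.HasAntidiagonal.antidiagonal n, g p.1 • U p.2)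
    (n : ℕ) (x : A) (hx : x ∈ Rs F q m a U n) : γ x ∈ Rs F q m a U n := by
  have hUm : ∀ j ≤ m, U j ∈ Rs F q m a U (ww q m j + 1) := by
    intro j hj
    rcases j with _ | j
    · rw [hU0]; exact Rs_mono F a U (by omega) (Rs_one F hq)
    · have := mono_mem_Rs F hq hU0 hrel 0 (Pi.single (⟨j, by omega⟩ : Fin m) 1) (ww q m (j+1) + 1) (by
        rw [wt_single]; simp)
      rwa [mono_single, pow_one] at this
  have hγm : ∀ j ≤ m, γ (U j) ∈ Rs F q m a U (ww q m j + 1) := by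
    intro j hj
    rw [hγU j hj]
    refine Submodule.sum_mem _ fun p hp => Submodule.smul_mem _ _ ?_
    rw [Finset.HasAntidiagonal.mem_antidiagonal] at hp
    exact Rs_mono F a U (by have := ww_mono q m (show p.2 ≤ j by omega); omega) (hUm p.2 (by omega))
  have hpow : ∀ (k n : ℕ) (y : A), y ∈ Rs F q m a U (n+1) → y ^ k ∈ Rs F q m a U (k*n+1) := by
    intro k n y hy
    induction k with
    | zero => simpa using Rs_one F hq
    | succ k ih => rw [pow_succ, Nat.succ_mul]; exact Rs_mul F hq hU0 hrel _ _ _ _ ih hy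
  have hprod : ∀ (s : Finset (Fin m)) (k : Fin m → ℕ) (y : Fin m → A), (∀ j, y j ∈ Rs F q m a U (k j + 1)) →
      ∏ j ∈ s, y j ∈ Rs F q m a U (∑ j ∈ s, k j + 1) := by
    intro s k y hy
    classical
    induction s using Finset.induction_on with
    | empty => simpa using Rs_one F hq
    | insert j s hj ih =>
      rw [Finset.prod_insert hj, Finset.sum_insert hj]
      exact Rs_mul F hq hU0 hrel _ _ _ _ (hy j) ih
  unfold Rs at hx
  induction hx using Submodule.span_induction with
  | mem x hx =>
    obtain ⟨i, e, he, hn, rfl⟩ := hx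
    have : γ (mono m a U i e) = a ^ i * ∏ j : Fin m, γ (U (j+1)) ^ e j := by
      unfold mono; rw [map_mul, map_pow, hγa, map_prod]; simp only [map_pow]
    rw [this]
    have ha : a ^ i ∈ Rs F q m a U (i * q^m + 1) := by
      have := mono_mem_Rs F hq hU0 hrel i 0 (i * q^m + 1) (by rw [wt_a]; omega)
      rwa [mono_a] at this
    refine Rs_mono F a U ?_ (Rs_mul F hq hU0 hrel _ _ _ _ ha
      (hprod Finset.univ (fun j => e j * ww q m (j+1)) _ fun j => hpow _ _ _ (hγm (j+1) (by omega))))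
    exact hn
  | zero => simp
  | add x y _ _ h1 h2 => rw [map_add]; exact Submodule.add_mem _ h1 h2
  | smul c x _ h => rw [map_smul]; exact Submodule.smul_mem _ _ h

end Mono

section Val
variable {Γ : Type*} [LinearOrderedCommGroupWithZero Γ] {Ω : Type*} [CommRing Ω] (v : Valuation Ω Γ)
  {q : ℕ} {a : Ω} {V : ℕ → Ω}

lemma val_step (hq : 2 ≤ q) (hV0 : V 0 = 1) (ha : 1 < v a) (m : ℕ) (hrel : ∀ j < m, V (j+1) ^ q = V (j+1) - a * V j) (n : ℕ) (hn : n ≤ m) :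
    1 ≤ v (V n) ∧ (n < m → v (V (n+1)) ^ q = v a * v (V n)) := by
  have key : ∀ n < m, 1 ≤ v (V n) → 1 < v (V (n+1)) ∧ v (V (n+1)) ^ q = v a * v (V n) := by
    intro n hn h
    have e : a * V n = V (n+1) - V (n+1) ^ q := by rw [hrel n hn]; ring
    have h1 : 1 < v (a * V n) := by
      rw [map_mul]
      calc (1:Γ) < v a := ha
        _ = v a * 1 := (mul_one _).symm
        _ ≤ v a * v (V n) := by gcongr
    have h2 : 1 < v (V (n+1)) := by
      by_contra hc
      push Not at hc
      rw [e] at h1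
      refine absurd h1 (not_lt.2 ?_)
      refine (v.map_sub _ _).trans (max_le hc ?_)
      rw [map_pow]; exact pow_le_one₀ zero_le hc
    refine ⟨h2, ?_⟩
    rw [← map_mul, e, Valuation.map_sub_eq_of_lt_right, map_pow]
    rw [map_pow]
    exact lt_self_pow₀ h2 (by omega)
  have h1 : ∀ n ≤ m, 1 ≤ v (V n) := by
    intro n
    induction n with
    | zero => intro _; rw [hV0, map_one]
    | succ n ih => intro hn; exact (key n (by omega) (ih (by omega))).1.le
  exact ⟨h1 n hn, fun hn' => (key n hn' (h1 n hn)).2⟩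

lemma val_beta (hq : 2 ≤ q) (hV0 : V 0 = 1) (ha : 1 < v a) (m : ℕ) (hrel : ∀ j < m, V (j+1) ^ q = V (j+1) - a * V j) :
    ∃ β : Γ, 1 < β ∧ ∀ i, ∀ e : Fin m → ℕ, v (mono m a V i e) = β ^ wt q m i e := by
  have hs := val_step v hq hV0 ha m hrel
  have hne : ∀ n ≤ m, v (V n) ≠ 0 := fun n hn => (zero_lt_one.trans_le (hs n hn).1).ne'
  set ρ : ℕ → Γ := fun n => if n = 0 then v a else v (V n) / v (V (n-1)) with hρ
  have hρs : ∀ n < m, ρ (n+1) ^ q = ρ n := by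
    intro n hn
    simp only [hρ, Nat.add_eq_zero_iff, one_ne_zero, and_false, if_false, Nat.add_sub_cancel]
    rw [div_pow, (hs n hn.le).2 hn]
    rcases n with _ | n
    · simp [hV0]
    · have h1 := (hs n (by omega)).2 (by omega)
      rw [h1]
      simp only [Nat.add_eq_zero_iff, one_ne_zero, and_false, if_false, Nat.add_sub_cancel]
      have ha0 : v a ≠ 0 := (zero_lt_one.trans ha).ne'
      have := hne n (by omega)
      rw [mul_div_mul_left _ _ ha0]
  have hρm : ∀ k n, n + k = m → ρ n = ρ m ^ q ^ k := by
    intro k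
    induction k with
    | zero => intro n hn; rw [add_zero] at hn; rw [hn]; simp
    | succ k ih =>
      intro n hn
      rw [← hρs n (by omega), ih (n+1) (by omega), ← pow_mul, pow_succ]
  have hρ0 : v a = ρ m ^ q ^ m := by
    rw [← hρm m 0 (by omega)]; simp [hρ]
  have hVn : ∀ n ≤ m, v (V n) = ρ m ^ ww q m n := by
    intro n
    induction n with
    | zero => intro _; simp [hV0, ww]
    | succ n ih =>
      intro hn
      unfold ww
      rw [Finset.sum_range_succ, pow_add, ← hρm (m-1-n) (n+1) (by omega)]
      have := ih (by omega)
      unfold ww at this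
      rw [← this]
      simp only [hρ, Nat.add_eq_zero_iff, one_ne_zero, and_false, if_false, Nat.add_sub_cancel]
      rw [mul_div_cancel₀ _ (hne n (by omega))]
  refine ⟨ρ m, ?_, ?_⟩
  · by_contra hc
    push Not at hc
    rw [hρ0] at ha
    exact absurd ha (not_lt.2 (pow_le_one₀ zero_le hc))
  · intro i e
    unfold mono wt
    rw [map_mul, map_pow, map_prod, hρ0, pow_add, mul_comm i, pow_mul]
    congr 1
    rw [← Finset.prod_pow_eq_pow_sum]
    refine Finset.prod_congr rfl fun j _ => ?_
    rw [map_pow, hVn (j+1) (by omega), mul_comm (e j), pow_mul]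
end Val

lemma exists_V {Ω : Type*} [Field Ω] [IsAlgClosed Ω] {q : ℕ} (hq : 2 ≤ q) (a : Ω) :
    ∃ V : ℕ → Ω, V 0 = 1 ∧ ∀ j, V (j+1) ^ q = V (j+1) - a * V j := by
  have h : ∀ b : Ω, ∃ x : Ω, x ^ q = x - b := by
    intro b
    have hd : (X ^ q - X + C b : Polynomial Ω).natDegree = q := by
      compute_degree!
      · rw [if_neg (show ¬ (1:ℕ) = q by omega), if_neg (show ¬ q = 0 by omega)]; simp
      · omega
    obtain ⟨x, hx⟩ := IsAlgClosed.exists_root (X ^ q - X + C b : Polynomial Ω) (by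
      intro h0
      have h1 := natDegree_eq_of_degree_eq_some (n := 0) h0
      omega)
    refine ⟨x, ?_⟩
    simp [IsRoot] at hx
    linear_combination hx
  choose f hf using h
  exact ⟨fun n => Nat.rec 1 (fun _ x => f (a * x)) n, rfl, fun j => hf _⟩

lemma exists_val (F : Type*) [Field F] {Ω : Type*} [Field Ω] [Algebra F Ω] {a : Ω} (ha : Transcendental F a) :
    ∃ V : ValuationSubring Ω, 1 < V.valuation a ∧ ∀ c : F, c ≠ 0 → V.valuation (algebraMap F Ω c) = 1 := by
  have hx : a ∉ (integralClosure F Ω).toSubring := by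
    intro h
    have h2 : IsIntegral F a := h
    exact ha h2.isAlgebraic
  obtain ⟨V, h1, h2⟩ := Subring.exists_le_valuationSubring_of_isIntegrallyClosedIn hx
  have h3 : ∀ c : F, V.valuation (algebraMap F Ω c) ≤ 1 := by
    intro c
    rw [V.valuation_le_one_iff]
    exact h1 (show IsIntegral F _ from isIntegral_algebraMap)
  refine ⟨V, ?_, ?_⟩
  · rw [← V.valuation_le_one_iff] at h2; exact not_le.1 h2
  · intro c hc
    refine le_antisymm (h3 c) ?_
    have h4 := h3 c⁻¹
    rw [map_inv₀, map_inv₀] at h4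
    have : V.valuation (algebraMap F Ω c) ≠ 0 := by simpa using hc
    exact (inv_le_one₀ (zero_lt_iff.2 this)).1 h4

section AA
variable (F : Type*) [Field F] [Fintype F] (m : ℕ)

/-- generators before quotient -/
noncomputable def UP (n : ℕ) : MvPolynomial (Option (Fin m)) F :=
  if n = 0 then 1 else if h : n - 1 < m then MvPolynomial.X (some ⟨n-1, h⟩) else 0

/-- relations -/
noncomputable def relI : Ideal (MvPolynomial (Option (Fin m)) F) :=
  Ideal.span (Set.range fun j : Fin m =>
    UP F m (j+1) ^ Fintype.card F - (UP F m (j+1) - MvPolynomial.X none * UP F m j))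

/-- the coordinate ring -/
abbrev AA := MvPolynomial (Option (Fin m)) F ⧸ relI F m

/-- generator -/
noncomputable def aA : AA F m := Ideal.Quotient.mkₐ F (relI F m) (MvPolynomial.X none)
/-- generators -/
noncomputable def UA (n : ℕ) : AA F m := Ideal.Quotient.mkₐ F (relI F m) (UP F m n)

lemma UA_zero : UA F m 0 = 1 := by simp [UA, UP]

lemma UA_rel : ∀ j < m, UA F m (j+1) ^ Fintype.card F = UA F m (j+1) - aA F m * UA F m j := by
  intro j hj
  unfold UA aA
  rw [← map_pow, ← map_mul, ← map_sub, ← sub_eq_zero, ← map_sub, Ideal.Quotient.mkₐ_eq_mk, Ideal.Quotient.eq_zero_iff_mem]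
  exact Ideal.subset_span ⟨⟨j, hj⟩, rfl⟩

lemma AA_gen : Algebra.adjoin F (insert (aA F m) (Set.range fun j : Fin m => UA F m (j+1))) = ⊤ := by
  have h := MvPolynomial.adjoin_range_X (σ := Option (Fin m)) (R := F)
  have h2 := congrArg (Subalgebra.map (Ideal.Quotient.mkₐ F (relI F m))) h
  rw [AlgHom.map_adjoin, Algebra.map_top, (AlgHom.range_eq_top _).2 (Ideal.Quotient.mkₐ_surjective F _)] at h2
  rw [eq_top_iff, ← h2]
  apply Algebra.adjoin_mono
  rintro _ ⟨_, ⟨o, rfl⟩, rfl⟩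
  rcases o with _ | j
  · left; rfl
  · right; refine ⟨j, ?_⟩
    simp [UA, UP]

variable {F m}
lemma AA_lift {R : Type*} [CommRing R] [Algebra F R] {a : R} {V : ℕ → R} (hV0 : V 0 = 1)
    (hrel : ∀ j < m, V (j+1) ^ Fintype.card F = V (j+1) - a * V j) :
    ∃ φ : AA F m →ₐ[F] R, φ (aA F m) = a ∧ ∀ n ≤ m, φ (UA F m n) = V n := by
  set ψ : MvPolynomial (Option (Fin m)) F →ₐ[F] R :=
    MvPolynomial.aeval (fun o => o.elim a (fun j : Fin m => V (j+1))) with hψ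
  have hψU : ∀ n ≤ m, ψ (UP F m n) = V n := by
    intro n hn
    rcases n with _ | n
    · simp [UP, hV0]
    · simp only [UP, Nat.add_eq_zero_iff, one_ne_zero, and_false, if_false, Nat.add_sub_cancel]
      rw [dif_pos (show n < m by omega)]
      simp [hψ]
  have hψa : ψ (MvPolynomial.X none) = a := by simp [hψ]
  have hk : ∀ x ∈ relI F m, ψ x = 0 := by
    intro x hx
    have : relI F m ≤ RingHom.ker ψ := by
      unfold relI
      rw [Ideal.span_le]
      rintro _ ⟨j, rfl⟩
      simp only [SetLike.mem_coe, RingHom.mem_ker]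
      rw [map_sub, map_sub, map_pow, map_mul, hψU _ (by omega), hψU _ (by omega), hψa, hrel j j.2, sub_self]
    exact this hx
  refine ⟨Ideal.Quotient.liftₐ (relI F m) ψ hk, hψa, fun n hn => hψU n hn⟩

lemma AA_ext {R : Type*} [CommRing R] [Algebra F R] {φ ψ : AA F m →ₐ[F] R} (ha : φ (aA F m) = ψ (aA F m))
    (hU : ∀ n ≤ m, φ (UA F m n) = ψ (UA F m n)) : φ = ψ := by
  apply AlgHom.ext_of_adjoin_eq_top (AA_gen F m)
  rintro x (rfl | ⟨j, rfl⟩)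
  · exact ha
  · exact hU _ (by omega)

lemma two_le_card : 2 ≤ Fintype.card F := Fintype.one_lt_card

open Classical in
theorem stepanov_AA {K : Type*} [Field K] [Algebra F K] : ∃ W : ℕ,
    ∀ (γ : AA F m →ₐ[F] AA F m) (g : ℕ → F), γ (aA F m) = aA F m →
      (∀ n ≤ m, γ (UA F m n) = ∑ p ∈ Finset.HasAntidiagonal.antidiagonal n, g p.1 • UA F m p.2) →
      ∀ t s, s = Fintype.card F ^ t → W^2+3*W+1 < s → ∀ S : Finset (AA F m →ₐ[F] K),
      (∀ x ∈ S, ∀ b, x (γ b) = x b ^ (s^2)) → S.card ≤ s^2 + (3*W+1)*s := by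
  have hq : 2 ≤ Fintype.card F := two_le_card
  obtain ⟨V, hV0, hV⟩ := exists_V hq (algebraMap (RatFunc F) (AlgebraicClosure (RatFunc F)) RatFunc.X)
  have htr : Transcendental F (algebraMap (RatFunc F) (AlgebraicClosure (RatFunc F)) RatFunc.X) :=
    (transcendental_algebraMap_iff (algebraMap (RatFunc F) (AlgebraicClosure (RatFunc F))).injective).2
      RatFunc.transcendental_X
  obtain ⟨VR, hv1, hv2⟩ := exists_val F htr
  obtain ⟨φ, hφa, hφU⟩ := AA_lift (F := F) (m := m) hV0 (fun j _ => hV j)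
  set v : Valuation (AA F m) _ := VR.valuation.comap (φ : AA F m →+* AlgebraicClosure (RatFunc F)) with hv
  have hva : 1 < v (aA F m) := by
    rw [hv, Valuation.comap_apply]
    have : (φ : AA F m →+* AlgebraicClosure (RatFunc F)) (aA F m) = φ (aA F m) := rfl
    rw [this, hφa]; exact hv1
  obtain ⟨β, hβ, hB⟩ := val_beta v hq (UA_zero F m) hva m (UA_rel F m)
  refine ⟨∑ j : Fin m, Fintype.card F * ww (Fintype.card F) m (j+1), ?_⟩
  intro γ g hγa hγU t s hs hsW S hS
  refine stepanov (H := HH (Fintype.card F) m) (B := BB (Fintype.card F) m (aA F m) (UA F m)) v (β := β)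
    ?_ hβ ?_ _ (fun h hh => wt_surj hq hh) ?_ ?_ ?_ γ ?_ t s hs hsW S hS
  · intro c hc
    rw [hv, Valuation.comap_apply]
    have : (φ : AA F m →+* AlgebraicClosure (RatFunc F)) (algebraMap F _ c) = algebraMap F _ c := φ.commutes c
    rw [this]; exact hv2 c hc
  · rintro _ ⟨i, e, he, rfl⟩
    rw [BB_wt hq _ _ _ _ he, hB]
  · rw [Ls_eq_Rs F hq]; exact Rs_one F hq
  · intro n n' x y
    simp only [Ls_eq_Rs F hq]
    exact Rs_mul F hq (UA_zero F m) (UA_rel F m) n n' x y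
  · intro x
    obtain ⟨n, hn⟩ := Rs_span F hq (UA_zero F m) (UA_rel F m) (AA_gen F m) x
    exact ⟨n+1, by rwa [Ls_eq_Rs F hq]⟩
  · intro n x
    simp only [Ls_eq_Rs F hq]
    exact Rs_twist F hq (UA_zero F m) (UA_rel F m) γ hγa g hγU n x
end AA

section Pts
variable {F : Type*} [Field F] [Fintype F] {m : ℕ}

lemma twist_rel {R : Type*} [CommRing R] [Algebra F R] {a : R} {U : ℕ → R} (hU0 : U 0 = 1)
    (hrel : ∀ j < m, U (j+1) ^ Fintype.card F = U (j+1) - a * U j) (c : ℕ → F) (j : ℕ) (hj : j < m) :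
    (∑ p ∈ Finset.HasAntidiagonal.antidiagonal (j+1), c p.1 • U p.2) ^ Fintype.card F =
      (∑ p ∈ Finset.HasAntidiagonal.antidiagonal (j+1), c p.1 • U p.2) -
      a * ∑ p ∈ Finset.HasAntidiagonal.antidiagonal j, c p.1 • U p.2 := by
  have hfr : ∀ x : R, x ^ Fintype.card F = FiniteField.frobeniusAlgHom F R x := fun x => rfl
  rw [hfr, map_sum, Finset.Nat.sum_antidiagonal_succ', Finset.Nat.sum_antidiagonal_succ', Finset.mul_sum, add_sub_assoc,
    ← Finset.sum_sub_distrib]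
  congr 1
  · rw [map_smul, hU0, map_one]
  · refine Finset.sum_congr rfl fun p hp => ?_
    rw [Finset.HasAntidiagonal.mem_antidiagonal] at hp
    rw [map_smul, ← hfr, hrel p.2 (by omega), smul_sub, mul_smul_comm]

lemma exists_tw {R : Type*} [CommRing R] [Algebra F R] {a : R} {U : ℕ → R} (hU0 : U 0 = 1)
    (hrel : ∀ j < m, U (j+1) ^ Fintype.card F = U (j+1) - a * U j) (c : ℕ → F) (hc : c 0 = 1) :
    ∃ γ : AA F m →ₐ[F] R, γ (aA F m) = a ∧
    ∀ n ≤ m, γ (UA F m n) = ∑ p ∈ Finset.HasAntidiagonal.antidiagonal n, c p.1 • U p.2 := by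
  have h0 : (∑ p ∈ Finset.HasAntidiagonal.antidiagonal 0, c p.1 • U p.2) = 1 := by
    rw [Finset.Nat.antidiagonal_zero, Finset.sum_singleton, hc, hU0, one_smul]
  have h1 := fun j hj => twist_rel hU0 hrel c j hj
  exact AA_lift (F := F) (m := m) (a := a) (V := fun n => ∑ p ∈ Finset.HasAntidiagonal.antidiagonal n, c p.1 • U p.2) h0 h1

lemma exists_twist (c : ℕ → F) (hc : c 0 = 1) : ∃ γ : AA F m →ₐ[F] AA F m, γ (aA F m) = aA F m ∧
    ∀ n ≤ m, γ (UA F m n) = ∑ p ∈ Finset.HasAntidiagonal.antidiagonal n, c p.1 • UA F m p.2 := by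
  exact exists_tw (UA_zero F m) (UA_rel F m) c hc

lemma exists_rep (g : GG F m) : ∃ u : (PowerSeries F)ˣ, PowerSeries.constantCoeff (u : PowerSeries F) = 1 ∧ mkG F m u = g := by
  obtain ⟨c, hc⟩ := (cls_mon_bij m).2 g
  exact ⟨toU (mon m c), toU_const (mon_monic _ _), hc⟩

lemma frob_iter {R : Type*} [CommRing R] [Algebra F R] (n : ℕ) :
    ∃ Φ : R →ₐ[F] R, ∀ x, Φ x = x ^ (Fintype.card F ^ n) := by
  induction n with
  | zero => exact ⟨AlgHom.id F R, fun x => by simp⟩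
  | succ n ih =>
    obtain ⟨Φ, h⟩ := ih
    refine ⟨(FiniteField.frobeniusAlgHom F R).comp Φ, fun x => ?_⟩
    have : (FiniteField.frobeniusAlgHom F R) (Φ x) = (Φ x) ^ Fintype.card F := rfl
    rw [AlgHom.comp_apply, this, h, ← pow_mul, pow_succ]

local notation "K" => AlgebraicClosure F
local notation "q" => Fintype.card F

lemma V_iter {a : K} {V : ℕ → K} (hV0 : V 0 = 1) (hV : ∀ j, V (j+1) ^ q = V (j+1) - a * V j) (i k : ℕ) :
    V k ^ (q ^ i) = PowerSeries.coeff k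
      ((∏ j ∈ Finset.range i, (1 - PowerSeries.C (a ^ q ^ j) * PowerSeries.X)) * PowerSeries.mk V) := by
  induction i generalizing k with
  | zero => simp
  | succ i ih =>
    obtain ⟨Φ, hΦ⟩ := frob_iter (F := F) (R := K) i
    rw [Finset.prod_range_succ, mul_comm (∏ j ∈ Finset.range i, _), mul_assoc, sub_mul, one_mul, map_sub, ← ih, mul_assoc,
      PowerSeries.coeff_C_mul, pow_succ', pow_mul]
    rcases k with _ | k
    · simp [hV0]
    · rw [PowerSeries.coeff_succ_X_mul, ← ih, hV, ← hΦ, ← hΦ, ← hΦ, ← hΦ, map_sub, map_mul]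

lemma toU_QF {i : ℕ} {a : K} (ha : a ^ q ^ i = a) :
    PowerSeries.map (algebraMap F K) (toU (QF i a) : PowerSeries F) =
      ∏ j ∈ Finset.range i, (1 - PowerSeries.C (a ^ q ^ j) * PowerSeries.X) := by
  rw [toU_coe (QF_monic ha).ne_zero, ← Polynomial.polynomial_map_coe]
  have h1 : (QF i a).reverse.map (algebraMap F K) = (QK i a).reverse := by
    rw [← QF_map ha]
    ext n
    rw [coeff_map, coeff_reverse, coeff_reverse, coeff_map, natDegree_map]
  rw [h1]
  have h2 : (QK i a).reverse = ∏ j ∈ Finset.range i, (1 - C (a ^ q ^ j) * X) := by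
    unfold QK
    clear h1 ha
    induction i with
    | zero => simpa using reverse_C (1 : K)
    | succ i ih =>
      rw [Finset.prod_range_succ, Finset.prod_range_succ, reverse_mul_of_domain, ih]
      congr 1
      generalize a ^ q ^ i = b
      ext n
      rw [coeff_reverse, natDegree_X_sub_C]
      rcases n with _ | _ | n
      · simp
      · simp [coeff_one]
      · rw [revAt_eq_self_of_lt (by omega)]
        simp [coeff_X, coeff_C, coeff_one]
  rw [h2, ← Polynomial.coeToPowerSeries.ringHom_apply, map_prod]
  simp

lemma coeff_mul_congr {R : Type*} [CommRing R] {f f' g : PowerSeries R} {n : ℕ} (h : ∀ i ≤ n, PowerSeries.coeff i f = PowerSeries.coeff i f') :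
    PowerSeries.coeff n (f * g) = PowerSeries.coeff n (f' * g) := by
  rw [PowerSeries.coeff_mul, PowerSeries.coeff_mul]
  refine Finset.sum_congr rfl fun p hp => ?_
  rw [Finset.HasAntidiagonal.mem_antidiagonal] at hp
  rw [h p.1 (by omega)]

lemma coeff_cancel {R : Type*} [CommRing R] {f f' g : PowerSeries R} (hg : PowerSeries.constantCoeff g = 1) {n : ℕ}
    (h : ∀ i ≤ n, PowerSeries.coeff i (f * g) = PowerSeries.coeff i (f' * g)) :
    ∀ i ≤ n, PowerSeries.coeff i f = PowerSeries.coeff i f' := by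
  have hu : IsUnit g := by rw [PowerSeries.isUnit_iff_constantCoeff, hg]; exact isUnit_one
  obtain ⟨g', hg'⟩ := hu.exists_right_inv
  intro i hi
  have : ∀ f : PowerSeries R, f = (f * g) * g' := by intro f; rw [mul_assoc, hg', mul_one]
  rw [this f, this f']
  exact coeff_mul_congr fun j hj => h j (by omega)

lemma tw_eq (u : PowerSeries F) (V : ℕ → K) (n : ℕ) :
    ∑ p ∈ Finset.HasAntidiagonal.antidiagonal n, PowerSeries.coeff p.1 u • V p.2 =
      PowerSeries.coeff n (PowerSeries.map (algebraMap F K) u * PowerSeries.mk V) := by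
  rw [PowerSeries.coeff_mul]
  refine Finset.sum_congr rfl fun p _ => ?_
  rw [PowerSeries.coeff_map, PowerSeries.coeff_mk, Algebra.smul_def]

lemma exists_pt (u : PowerSeries F) (hu : PowerSeries.coeff 0 u = 1) {a : K} {V : ℕ → K} (hV0 : V 0 = 1)
    (hV : ∀ j, V (j+1) ^ q = V (j+1) - a * V j) : ∃ x : AA F m →ₐ[F] K, x (aA F m) = a ∧
      ∀ n ≤ m, x (UA F m n) = PowerSeries.coeff n
        (PowerSeries.map (algebraMap F K) u * PowerSeries.mk V) := by
  obtain ⟨x, hx1, hx2⟩ := exists_tw (m := m) hV0 (fun j _ => hV j) (fun n => PowerSeries.coeff n u) hu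
  refine ⟨x, hx1, fun n hn => ?_⟩
  rw [hx2 n hn]
  exact tw_eq u V n

set_option maxHeartbeats 400000 in
open Classical in
theorem count_bound : ∃ C T : ℕ, ∀ t, T ≤ t → t ≠ 0 ∧ ∀ g : GG F m,
    q ^ m * ((Fi F (2*t)).filter (fun a => cls m (QF (2*t) a) = g)).card ≤ q ^ (2*t) + C * q ^ t := by
  have hq : 2 ≤ q := two_le_card
  obtain ⟨W, hW⟩ := @stepanov_AA F _ _ m (AlgebraicClosure F) _ _
  refine ⟨3*W+1, W^2+3*W+2, fun t ht => ⟨by omega, fun g => ?_⟩⟩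
  have ht0 : 2 * t ≠ 0 := by omega
  have hts : t < q ^ t := Nat.lt_pow_self (by omega)
  choose rep hrep1 hrep2 using (exists_rep : ∀ g : GG F m, _)
  choose V hV0 hV using (fun a : K => exists_V hq a)
  -- the twist
  set G : PowerSeries F := (rep g : PowerSeries F) with hG
  have hG0 : PowerSeries.coeff 0 G = 1 := by
    rw [PowerSeries.coeff_zero_eq_constantCoeff_apply]; exact hrep1 g
  obtain ⟨γ, hγa, hγU⟩ := exists_twist (m := m) (fun n => PowerSeries.coeff n G) hG0
  -- the points
  have hpt : ∀ (h : GG F m) (a : K), ∃ x : AA F m →ₐ[F] K, x (aA F m) = a ∧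
      ∀ n ≤ m, x (UA F m n) = PowerSeries.coeff n
        (PowerSeries.map (algebraMap F K) (rep h : PowerSeries F) * PowerSeries.mk (V a)) := by
    intro h a
    exact exists_pt _ (by rw [PowerSeries.coeff_zero_eq_constantCoeff_apply]; exact hrep1 h) (hV0 a) (hV a)
  choose x hxa hxU using hpt
  set D := (Finset.univ : Finset (GG F m)) ×ˢ ((Fi F (2*t)).filter (fun a => cls m (QF (2*t) a) = g)) with hD
  have hinj : Function.Injective (fun p : GG F m × K => x p.1 p.2) := by
    rintro ⟨h, a⟩ ⟨h', a'⟩ he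
    simp only at he
    have ha : a = a' := by rw [← hxa h a, ← hxa h' a', he]
    subst ha
    refine Prod.ext ?_ rfl
    simp only
    rw [← hrep2 h, ← hrep2 h', GG_eq_iff m (hrep1 h) (hrep1 h')]
    have h1 : ∀ i ≤ m, PowerSeries.coeff i (PowerSeries.map (algebraMap F K) (rep h : PowerSeries F) * PowerSeries.mk (V a)) =
      PowerSeries.coeff i (PowerSeries.map (algebraMap F K) (rep h' : PowerSeries F) * PowerSeries.mk (V a)) := by
      intro i hi
      rw [← hxU h a i hi, ← hxU h' a i hi, he]
    have h2 := coeff_cancel (by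
      rw [← PowerSeries.coeff_zero_eq_constantCoeff_apply, PowerSeries.coeff_mk, hV0]) h1
    intro i hi
    have := h2 i hi
    rw [PowerSeries.coeff_map, PowerSeries.coeff_map] at this
    exact (algebraMap F K).injective this
  have hcard : (D.image (fun p : GG F m × K => x p.1 p.2)).card = 
      q ^ m * ((Fi F (2*t)).filter (fun a => cls m (QF (2*t) a) = g)).card := by
    rw [Finset.card_image_of_injective _ hinj, hD, Finset.card_product, Finset.card_univ, card_GG]
  rw [← hcard, mul_comm 2 t, pow_mul]
  refine hW γ (fun n => PowerSeries.coeff n G) hγa hγU t (q^t) rfl (by omega) _ ?_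
  intro y hy
  obtain ⟨⟨h, a⟩, hp, rfl⟩ := Finset.mem_image.1 hy
  rw [hD, Finset.mem_product, Finset.mem_filter] at hp
  obtain ⟨-, haF, hacls⟩ := hp
  simp only at haF hacls ⊢
  have ha := (mem_Fi ht0).1 haF
  obtain ⟨Φ, hΦ⟩ := frob_iter (F := F) (R := K) (2*t)
  have hcomp : (x h a).comp γ = Φ.comp (x h a) := by
    apply AA_ext
    · rw [AlgHom.comp_apply, AlgHom.comp_apply, hγa, hxa, hΦ, ha]
    · intro n hn
      rw [AlgHom.comp_apply, AlgHom.comp_apply, hγU n hn, map_sum, hxU h a n hn, PowerSeries.coeff_mul, map_sum]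
      have hGk : ∀ k ≤ m, Φ (V a k) = PowerSeries.coeff k (PowerSeries.map (algebraMap F K) G * PowerSeries.mk (V a)) := by
        intro k hk
        rw [hΦ, V_iter (hV0 a) (hV a), ← toU_QF ha]
        apply coeff_mul_congr
        intro i hi
        rw [PowerSeries.coeff_map, PowerSeries.coeff_map]
        congr 1
        have e : mkG F m (toU (QF (2*t) a)) = mkG F m (rep g) := by rw [hrep2]; exact hacls
        exact (GG_eq_iff m (toU_const (QF_monic ha)) (hrep1 g)).1 e i (by omega)
      have l1 : ∑ p ∈ Finset.HasAntidiagonal.antidiagonal n, (x h a) (PowerSeries.coeff p.1 G • UA F m p.2) =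
          PowerSeries.coeff n (PowerSeries.map (algebraMap F K) G *
            (PowerSeries.map (algebraMap F K) (rep h : PowerSeries F) * PowerSeries.mk (V a))) := by
        rw [PowerSeries.coeff_mul]
        refine Finset.sum_congr rfl fun p hp => ?_
        rw [Finset.HasAntidiagonal.mem_antidiagonal] at hp
        rw [map_smul, hxU h a p.2 (by omega), PowerSeries.coeff_map, Algebra.smul_def]
      have l2 : PowerSeries.coeff n (PowerSeries.map (algebraMap F K) (rep h : PowerSeries F) *
            (PowerSeries.map (algebraMap F K) G * PowerSeries.mk (V a))) =
          ∑ p ∈ Finset.HasAntidiagonal.antidiagonal n, Φ (PowerSeries.coeff p.1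
            (PowerSeries.map (algebraMap F K) (rep h : PowerSeries F)) * PowerSeries.coeff p.2 (PowerSeries.mk (V a))) := by
        rw [PowerSeries.coeff_mul]
        refine Finset.sum_congr rfl fun p hp => ?_
        rw [Finset.HasAntidiagonal.mem_antidiagonal] at hp
        rw [map_mul Φ, PowerSeries.coeff_map, Φ.commutes, PowerSeries.coeff_mk, hGk p.2 (by omega)]
      rw [l1, ← l2]
      congr 1; ring
  intro b
  have := congrArg (fun φ : AA F m →ₐ[F] K => φ b) hcomp
  simp only [AlgHom.comp_apply] at this
  rw [this, hΦ, mul_comm 2 t, pow_mul]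

theorem weil_main (χ : AddChar (Additive (GG F m)) ℂ) (hχ : χ ≠ 0) :
    ‖∑ a : F, chi χ (X - C a)‖ ≤ m * Real.sqrt (Fintype.card F) := by
  obtain ⟨c, T, h⟩ := count_bound (F := F) (m := m)
  exact weil_of_bound hχ c T fun t ht => bound_of_count hχ c t (h t ht).1 (h t ht).2
end Pts

/-- For `f` of degree `k+m ≤ q-1`, the number `N(f, k+m)` of polynomials
`g` of degree at most `k-1` such that `f+g` has exactly `k+m` distinct roots in `F_q`
satisfies `|N(f,k+m) - q^(-m) C(q, k+m)| ≤ C(q/p + m√q + k + m, k+m)`. -/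
theorem stmt_11 {F : Type*} [Field F] [Fintype F] [DecidableEq F]
    (q p : ℕ) (hcard : Fintype.card F = q) [hp : Fact p.Prime] [CharP F p]
    (k m : ℕ) (hk : 1 ≤ k) (hkm : k + m ≤ q - 1)
    (f : Polynomial F) (hf : f.natDegree = k + m) :
    |(Nat.card {g : Polynomial F // g.degree < (k : ℕ) ∧
          (Finset.univ.filter (fun a : F => (f + g).eval a = 0)).card = k + m} : ℝ)
        - ((q : ℝ) ^ m)⁻¹ * (q.choose (k + m) : ℝ)|
      ≤ gchoose ((q : ℝ) / (p : ℝ) + (m : ℝ) * Real.sqrt q + (k : ℝ) + (m : ℝ))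
          ((k : ℝ) + (m : ℝ)) := by
  exact final_of_weil q p hcard k m hk f hf (by
    intro χ hχ
    have h := weil_main χ hχ
    rwa [hcard] at h)
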